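/- arXiv:0810.0868 — 2 statements merged into one kernel-verified Lean document; each statement's English description precedes it below -/
import Mathlib

section
/- There exists a constant C > 0 such that for all n ≥ 4 and all T ∈ BPT(n), ∑_{s ≥ 0} | q_s(T)/b(n) − e^{−λ_T} λ_T^s / s! | ≤ C/n, where λ_T = c_T/(2n) and q_s(T) = 0 for s > n−3. That is, the distribution of the number of shared nontrivial splits between T and a uniformly random tree in BPT(n) and the Poisson distribution with mean λ_T have variational distance O(n^{−1}). -/
open scoped Classical symmDiff

noncomputable section

/-- `b n = (2n-5)!!`, the number of fully resolved phylogenetic trees on `n` leaves. -/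
def numBPT (n : ℕ) : ℕ := ∏ k ∈ Finset.Icc 3 n, (2 * k - 5)

/-- `G`, together with the leaf-labelling `leaf`, is a fully resolved (binary)
phylogenetic tree on the leaf set `{1,…,n}`: a tree whose degree-one vertices are
exactly the (injectively) labelled leaves, all other vertices having degree three. -/
def IsBinaryPhylo {V : Type} [Fintype V] (n : ℕ) (G : SimpleGraph V) (leaf : Fin n → V) : Prop :=
  G.IsTree ∧ Function.Injective leaf ∧
    (∀ i, G.degree (leaf i) = 1) ∧
    ∀ v : V, v ∉ Set.range leaf → G.degree v = 3

/-- The split (bipartition of the leaf-label set, as an unordered pair of subsets of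
`Fin n`) induced by the edge `e`: each side consists of the labels of the leaves lying
in the corresponding component of `G` with `e` deleted. -/
def splitOfEdge {V : Type} [Fintype V] (n : ℕ) (G : SimpleGraph V) (leaf : Fin n → V)
    (e : Sym2 V) : Sym2 (Finset (Fin n)) :=
  e.map (fun u => Finset.univ.filter (fun i => (G.deleteEdges {e}).Reachable (leaf i) u))

/-- `c(T)`: the set of splits of the phylogenetic tree. -/
def splitsOf {V : Type} [Fintype V] (n : ℕ) (G : SimpleGraph V) (leaf : Fin n → V) :
    Finset (Sym2 (Finset (Fin n))) :=
  G.edgeFinset.image (splitOfEdge n G leaf)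

/-- A split is trivial if one of its sides is a singleton. -/
def IsTrivialSplit {n : ℕ} (σ : Sym2 (Finset (Fin n))) : Prop :=
  ∃ A ∈ σ, A.card = 1

/-- The collection of split systems of fully resolved phylogenetic trees on `{1,…,n}`;
since a fully resolved phylogenetic tree is determined, up to isomorphism fixing the
leaf labels, by its set of splits, this collection is in bijection with `BPT(n)`.
(Every fully resolved tree on `n` leaves has `n-2` internal vertices, hence is
isomorphic to one with vertex set `Fin n ⊕ Fin (n-2)`, leaves labelled by `Sum.inl`.) -/
def allBPTSplits (n : ℕ) : Finset (Finset (Sym2 (Finset (Fin n)))) :=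
  Finset.univ.filter (fun S => ∃ G : SimpleGraph (Fin n ⊕ Fin (n - 2)),
    IsBinaryPhylo n G Sum.inl ∧ splitsOf n G Sum.inl = S)

/-- The number of cherries of the tree: pairs of (distinct) leaves adjacent to a
common vertex. -/
def numCherries {V : Type} [Fintype V] (n : ℕ) (G : SimpleGraph V) (leaf : Fin n → V) : ℕ :=
  (Finset.univ.filter
    (fun p : Sym2 (Fin n) => ¬ p.IsDiag ∧ ∃ v : V, ∀ i ∈ p, G.Adj (leaf i) v)).card

/-- The internal edges of the tree: edges both of whose endpoints are internal
(non-leaf) vertices. -/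
def internalEdgesG {V : Type} [Fintype V] (n : ℕ) (G : SimpleGraph V) (leaf : Fin n → V) :
    Finset (Sym2 V) :=
  G.edgeFinset.filter (fun e => ∀ v ∈ e, v ∉ Set.range leaf)

/-- `N_E(T) = ∏ᵢ β(|E̊(Fᵢ)|)`, the product over all connected components `Fᵢ` of the
forest `T - E` of the number `β(m) = b(m+3)` of fully resolved trees with `m` internal
edges, where `m = |E̊(Fᵢ)|` is the number of internal edges of `T` contained in `Fᵢ`. -/
def NEdges {V : Type} [Fintype V] (n : ℕ) (G : SimpleGraph V) (leaf : Fin n → V)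
    (E : Finset (Sym2 V)) : ℕ :=
  ∏ C ∈ Finset.univ.image (G.deleteEdges (E : Set (Sym2 V))).connectedComponentMk,
    numBPT ((((internalEdgesG n G leaf) \ E).filter
      (fun e => ∀ v ∈ e, (G.deleteEdges (E : Set (Sym2 V))).connectedComponentMk v = C)).card + 3)

/-- `r_s(T) = ∑_{E ⊆ E̊(T), |E| = s} N_E(T)`. -/
def rCoeff {V : Type} [Fintype V] (n : ℕ) (G : SimpleGraph V) (leaf : Fin n → V) (s : ℕ) : ℕ :=
  ∑ E ∈ (internalEdgesG n G leaf).powerset.filter (fun E => E.card = s), NEdges n G leaf E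

/-- `q_s(T)`: the number of fully resolved phylogenetic trees on `{1,…,n}` (counted up
to isomorphism fixing leaf labels, i.e. counted via their split systems) sharing
exactly `s` nontrivial splits with `T`. -/
def qCoeff {V : Type} [Fintype V] (n : ℕ) (G : SimpleGraph V) (leaf : Fin n → V) (s : ℕ) : ℕ :=
  ((allBPTSplits n).filter (fun S =>
    ((S ∩ splitsOf n G leaf).filter (fun σ => ¬ IsTrivialSplit σ)).card = s)).card

end

section Laminar
set_option linter.unusedSectionVars false
variable {α : Type} [DecidableEq α]

def Compat (A B : Finset α) : Prop := A ⊆ B ∨ B ⊆ A ∨ Disjoint A B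

def Lam (F : Finset (Finset α)) : Prop :=
  (∀ A ∈ F, A.Nonempty) ∧ ∀ A ∈ F, ∀ B ∈ F, Compat A B

theorem Compat.symm {A B : Finset α} (h : Compat A B) : Compat B A := by
  rcases h with h | h | h
  · exact Or.inr (Or.inl h)
  · exact Or.inl h
  · exact Or.inr (Or.inr h.symm)

theorem Compat.nested {A B : Finset α} (h : Compat A B) {i : α} (hA : i ∈ A) (hB : i ∈ B) :
    A ⊆ B ∨ B ⊆ A := by
  rcases h with h | h | h
  · exact Or.inl h
  · exact Or.inr h
  · exact absurd hB (Finset.disjoint_left.mp h hA)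

def restr (x : α) (F : Finset (Finset α)) : Finset (Finset α) :=
  (F.image (fun C => C.erase x)).erase ∅

theorem mem_restr {x : α} {F : Finset (Finset α)} {C : Finset α} :
    C ∈ restr x F ↔ C.Nonempty ∧ x ∉ C ∧ (C ∈ F ∨ insert x C ∈ F) := by
  unfold restr
  rw [Finset.mem_erase, Finset.mem_image, ← Finset.nonempty_iff_ne_empty]
  constructor
  · rintro ⟨h, D, hD, rfl⟩
    refine ⟨h, by simp, ?_⟩
    by_cases hx : x ∈ D
    · right; rwa [Finset.insert_erase hx]
    · left; rwa [Finset.erase_eq_of_notMem hx]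
  · rintro ⟨h, hx, h1 | h1⟩
    · exact ⟨h, C, h1, Finset.erase_eq_of_notMem hx⟩
    · exact ⟨h, _, h1, Finset.erase_insert hx⟩

theorem Compat.erase {A B : Finset α} (x : α) (h : Compat A B) :
    Compat (A.erase x) (B.erase x) := by
  rcases h with h | h | h
  · exact Or.inl (Finset.erase_subset_erase _ h)
  · exact Or.inr (Or.inl (Finset.erase_subset_erase _ h))
  · exact Or.inr (Or.inr (h.mono (Finset.erase_subset _ _) (Finset.erase_subset _ _)))

theorem Lam.restr {F : Finset (Finset α)} (hF : Lam F) (x : α) : Lam (restr x F) := by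
  refine ⟨fun A hA => (mem_restr.1 hA).1, ?_⟩
  intro A hA B hB
  unfold _root_.restr at hA hB
  rw [Finset.mem_erase, Finset.mem_image] at hA hB
  obtain ⟨-, A', hA', rfl⟩ := hA
  obtain ⟨-, B', hB', rfl⟩ := hB
  exact (hF.2 _ hA' _ hB').erase x

/-- uniqueness of merging pairs -/
theorem Lam.pair_unique {F : Finset (Finset α)} (hF : Lam F) {x : α} {C C' : Finset α}
    (hC : C ∈ F) (hxC : x ∉ C) (hC1 : insert x C ∈ F)
    (hC' : C' ∈ F) (hxC' : x ∉ C') (hC1' : insert x C' ∈ F) : C = C' := by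
  have key : ∀ {C C' : Finset α}, C ∈ F → x ∉ C → insert x C ∈ F → C' ∈ F → x ∉ C' →
      insert x C' ∈ F → C ⊆ C' → C = C' := by
    intro C C' hC hxC hC1 hC' hxC' hC1' hs
    obtain ⟨i, hi⟩ := hF.1 _ hC
    rcases (hF.2 _ hC1 _ hC').nested (Finset.mem_insert_of_mem hi) (hs hi) with h | h
    · exact absurd (h (Finset.mem_insert_self _ _)) hxC'
    · refine Finset.Subset.antisymm hs ?_
      intro j hj
      have := h hj
      rw [Finset.mem_insert] at this
      rcases this with rfl | h
      · exact absurd hj hxC'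
      · exact h
  rcases (hF.2 _ hC1 _ hC1').nested (Finset.mem_insert_self _ _) (Finset.mem_insert_self _ _)
    with h | h
  · exact key hC hxC hC1 hC' hxC' hC1' ((Finset.insert_subset_insert_iff hxC).1 h)
  · exact (key hC' hxC' hC1' hC hxC hC1 ((Finset.insert_subset_insert_iff hxC').1 h)).symm

theorem card_step_aux {F : Finset (Finset α)} (hF : Lam F) (x : α) (E : Finset (Finset α))
    (hE : E ⊆ F) (hx : {x} ∉ E)
    (hno : ∀ C ∈ E, x ∉ C → insert x C ∉ E) : E.card ≤ (restr x F).card := by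
  apply Finset.card_le_card_of_injOn (fun C => C.erase x)
  · intro C hC
    have hC : C ∈ E := hC
    have hCF := hE hC
    show C.erase x ∈ restr x F
    unfold restr
    rw [Finset.mem_erase]
    refine ⟨?_, Finset.mem_image_of_mem _ hCF⟩
    intro h0
    by_cases h : x ∈ C
    · rw [← Finset.insert_erase h, h0] at hC
      exact hx hC
    · rw [Finset.erase_eq_of_notMem h] at h0
      have := hF.1 _ hCF
      simp [h0] at this
  · intro C hC D hD h
    have hC : C ∈ E := hC
    have hD : D ∈ E := hD
    simp only at h
    by_cases hxC : x ∈ C <;> by_cases hxD : x ∈ D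
    · rw [← Finset.insert_erase hxC, h, Finset.insert_erase hxD]
    · rw [Finset.erase_eq_of_notMem hxD] at h
      exfalso
      apply hno D hD hxD
      rw [← h, Finset.insert_erase hxC]; exact hC
    · rw [Finset.erase_eq_of_notMem hxC] at h
      exfalso
      apply hno C hC hxC
      rw [h, Finset.insert_erase hxD]; exact hD
    · rwa [Finset.erase_eq_of_notMem hxC, Finset.erase_eq_of_notMem hxD] at h

theorem card_step {F : Finset (Finset α)} (hF : Lam F) (x : α) :
    ((∃ B ∈ F, x ∉ B ∧ insert x B ∈ F) ∧ F.card ≤ (restr x F).card + 2) ∨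
      F.card ≤ (restr x F).card + 1 := by
  by_cases h : ∃ B ∈ F, x ∉ B ∧ insert x B ∈ F
  · left
    refine ⟨h, ?_⟩
    obtain ⟨B, hB, hxB, hB1⟩ := h
    have := card_step_aux hF x ((F.erase {x}).erase (insert x B))
      ((Finset.erase_subset _ _).trans (Finset.erase_subset _ _)) (by simp) (by
        intro C hC hxC hC1
        simp only [Finset.mem_erase] at hC hC1
        apply hC1.1
        rw [hF.pair_unique hB hxB hB1 hC.2.2 hxC hC1.2.2])
    have h1 := Finset.pred_card_le_card_erase (s := F) (a := {x})
    have h2 := Finset.pred_card_le_card_erase (s := F.erase {x}) (a := insert x B)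
    omega
  · right
    have := card_step_aux hF x (F.erase {x}) (Finset.erase_subset _ _) (by simp) (by
        intro C hC hxC hC1
        simp only [Finset.mem_erase] at hC hC1
        exact h ⟨C, hC.2, hxC, hC1.2⟩)
    have h1 := Finset.pred_card_le_card_erase (s := F) (a := {x})
    omega

theorem restr_subset {F : Finset (Finset α)} {x : α} {X : Finset α}
    (h : ∀ A ∈ F, A ⊆ insert x X) : ∀ A ∈ restr x F, A ⊆ X := by
  intro A hA
  obtain ⟨-, hx, h1 | h1⟩ := mem_restr.1 hA
  · exact (Finset.subset_insert_iff_of_notMem hx).1 (h _ h1)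
  · intro i hi
    have := h _ h1 (Finset.mem_insert_of_mem hi)
    rw [Finset.mem_insert] at this
    rcases this with rfl | h
    · exact absurd hi hx
    · exact h

theorem Lam.card_le {X : Finset α} (hX : X.Nonempty) : ∀ {F : Finset (Finset α)}, Lam F →
    (∀ A ∈ F, A ⊆ X) → F.card + 1 ≤ 2 * X.card := by
  induction hX using Finset.Nonempty.cons_induction with
  | singleton a =>
    intro F hF h
    have : F ⊆ {{a}} := by
      intro A hA
      rw [Finset.mem_singleton]
      exact (Finset.subset_singleton_iff.1 (h A hA)).resolve_left (hF.1 A hA).ne_empty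
    have := Finset.card_le_card this
    simp at this ⊢
    omega
  | cons x X hx hX ih =>
    intro F hF h
    rw [Finset.cons_eq_insert] at *
    have h1 := ih (hF.restr x) (restr_subset h)
    rw [Finset.card_insert_of_notMem hx]
    rcases card_step hF x with h | h <;> omega

noncomputable def Hier (X : Finset α) : Finset (Finset (Finset α)) :=
  X.powerset.powerset.filter (fun F => Lam F ∧ F.card + 1 = 2 * X.card)

theorem mem_Hier {X : Finset α} {H : Finset (Finset α)} :
    H ∈ Hier X ↔ (∀ A ∈ H, A ⊆ X) ∧ Lam H ∧ H.card + 1 = 2 * X.card := by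
  unfold Hier
  rw [Finset.mem_filter, Finset.mem_powerset]
  constructor
  · rintro ⟨h1, h2⟩
    exact ⟨fun A hA => Finset.mem_powerset.1 (h1 hA), h2⟩
  · rintro ⟨h1, h2⟩
    exact ⟨fun A hA => Finset.mem_powerset.2 (h1 A hA), h2⟩

theorem Compat.refl (A : Finset α) : Compat A A := Or.inl subset_rfl

theorem Hier.maximal {X : Finset α} {H : Finset (Finset α)} (hH : H ∈ Hier X) {A : Finset α}
    (hA : A.Nonempty) (hAX : A ⊆ X) (hc : ∀ B ∈ H, Compat A B) : A ∈ H := by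
  rw [mem_Hier] at hH
  obtain ⟨h1, h2, h3⟩ := hH
  by_contra hn
  have hl : Lam (insert A H) := by
    refine ⟨?_, ?_⟩
    · intro B hB
      rcases Finset.mem_insert.1 hB with rfl | hB
      · exact hA
      · exact h2.1 _ hB
    · intro B hB C hC
      rcases Finset.mem_insert.1 hB with hB' | hB' <;> rcases Finset.mem_insert.1 hC with hC' | hC'
      · rw [hB', hC']; exact Compat.refl _
      · rw [hB']; exact hc _ hC'
      · rw [hC']; exact (hc _ hB').symm
      · exact h2.2 _ hB' _ hC'
  have := hl.card_le (hA.mono hAX) (by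
    intro B hB
    rcases Finset.mem_insert.1 hB with rfl | hB
    · exact hAX
    · exact h1 _ hB)
  rw [Finset.card_insert_of_notMem hn] at this
  omega

theorem Hier.nonempty {X : Finset α} {H : Finset (Finset α)} (hH : H ∈ Hier X) : X.Nonempty := by
  rw [mem_Hier] at hH
  rw [← Finset.card_pos]
  omega

theorem Hier.top {X : Finset α} {H : Finset (Finset α)} (hH : H ∈ Hier X) : X ∈ H :=
  Hier.maximal hH (Hier.nonempty hH) subset_rfl (fun B hB => Or.inr (Or.inl ((mem_Hier.1 hH).1 B hB)))

theorem Hier.single {X : Finset α} {H : Finset (Finset α)} (hH : H ∈ Hier X) {x : α} (hx : x ∈ X) :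
    {x} ∈ H := by
  refine Hier.maximal hH (by simp) (by simpa using hx) (fun B hB => ?_)
  by_cases h : x ∈ B
  · left; simpa using h
  · right; right; simpa using h

/-- binary structure -/
theorem Hier.children {X : Finset α} {H : Finset (Finset α)} (hH : H ∈ Hier X) {A : Finset α}
    (hA : A ∈ H) (hc : 2 ≤ A.card) : ∃ B ∈ H, ∃ C ∈ H, Disjoint B C ∧ B ∪ C = A := by
  have hH' := mem_Hier.1 hH
  obtain ⟨h1, h2, h3⟩ := hH'
  obtain ⟨a, ha⟩ := h2.1 _ hA
  have hne : (H.filter (fun D => D ⊂ A)).Nonempty := by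
    refine ⟨{a}, ?_⟩
    rw [Finset.mem_filter]
    refine ⟨Hier.single hH (h1 _ hA ha), ?_⟩
    refine Finset.ssubset_iff_subset_ne.2 ⟨by simpa using ha, ?_⟩
    rintro rfl
    simp at hc
  obtain ⟨D, hD, hmax⟩ := Finset.exists_max_image _ Finset.card hne
  rw [Finset.mem_filter] at hD
  obtain ⟨hDH, hDA⟩ := hD
  refine ⟨D, hDH, A \ D, ?_, Finset.disjoint_sdiff, Finset.union_sdiff_of_subset hDA.1⟩
  apply Hier.maximal hH
  · rw [Finset.sdiff_nonempty]; exact hDA.2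
  · exact Finset.sdiff_subset.trans (h1 _ hA)
  · intro F hF
    rcases h2.2 _ hA _ hF with h | h | h
    · exact Or.inl (Finset.sdiff_subset.trans h)
    · rcases eq_or_ne F A with rfl | hne
      · exact Or.inl Finset.sdiff_subset
      have hFA : F ⊂ A := Finset.ssubset_iff_subset_ne.2 ⟨h, hne⟩
      rcases h2.2 _ hDH _ hF with h' | h' | h'
      · have := hmax F (Finset.mem_filter.2 ⟨hF, hFA⟩)
        rw [← Finset.eq_of_subset_of_card_le h' this]
        exact Or.inr (Or.inr Finset.sdiff_disjoint)
      · exact Or.inr (Or.inr (Finset.sdiff_disjoint.mono_right h'))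
      · exact Or.inr (Or.inl (Finset.subset_sdiff.2 ⟨h, h'.symm⟩))
    · exact Or.inr (Or.inr (h.mono_left Finset.sdiff_subset))

end Laminar

section Counting
set_option linter.unusedSectionVars false
variable {α : Type} [DecidableEq α]

noncomputable def ins (x : α) (H : Finset (Finset α)) (B : Finset α) : Finset (Finset α) :=
  (H.filter (fun C => ¬ B ⊂ C) ∪ (H.filter (fun C => B ⊆ C)).image (fun C => insert x C)) ∪ {{x}}

theorem mem_ins {x : α} {H : Finset (Finset α)} {B C : Finset α} :
    C ∈ ins x H B ↔ (C ∈ H ∧ ¬ B ⊂ C) ∨ (∃ D ∈ H, B ⊆ D ∧ insert x D = C) ∨ C = {x} := by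
  unfold ins
  simp only [Finset.mem_union, Finset.mem_filter, Finset.mem_image, Finset.mem_singleton, or_assoc,
    and_assoc]

theorem mem_ins_of_notMem {x : α} {H : Finset (Finset α)} {B C : Finset α} (hx : x ∉ C) :
    C ∈ ins x H B ↔ C ∈ H ∧ ¬ B ⊂ C := by
  rw [mem_ins]
  constructor
  · rintro (h | ⟨D, -, -, rfl⟩ | rfl)
    · exact h
    · simp at hx
    · simp at hx
  · exact Or.inl

theorem insert_mem_ins {x : α} {H : Finset (Finset α)} {B C : Finset α} (hx : x ∉ C)
    (hH : ∀ A ∈ H, x ∉ A) (hC : C.Nonempty) :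
    insert x C ∈ ins x H B ↔ C ∈ H ∧ B ⊆ C := by
  rw [mem_ins]
  constructor
  · rintro (h | ⟨D, hD, hB, h⟩ | h)
    · exact absurd (Finset.mem_insert_self _ _) (hH _ h.1)
    · have : D = C := by
        rw [← Finset.erase_insert hx, ← h, Finset.erase_insert (hH _ hD)]
      subst this
      exact ⟨hD, hB⟩
    · have : C = ∅ := by
        rw [← Finset.erase_insert hx, h]; simp
      simp [this] at hC
  · rintro ⟨h1, h2⟩
    exact Or.inr (Or.inl ⟨C, h1, h2, rfl⟩)

theorem restr_ins {x : α} {H : Finset (Finset α)} {B : Finset α} (hl : Lam H)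
    (hH : ∀ A ∈ H, x ∉ A) : restr x (ins x H B) = H := by
  ext C
  rw [mem_restr]
  constructor
  · rintro ⟨h1, h2, h3⟩
    rw [mem_ins_of_notMem h2, insert_mem_ins h2 hH h1] at h3
    rcases h3 with h | h <;> exact h.1
  · intro h
    have h1 := hl.1 _ h
    have h2 := hH _ h
    refine ⟨h1, h2, ?_⟩
    rw [mem_ins_of_notMem h2, insert_mem_ins h2 hH h1]
    by_cases hB : B ⊆ C
    · exact Or.inr ⟨h, hB⟩
    · exact Or.inl ⟨h, fun h' => hB h'.1⟩

theorem ins_inj {x : α} {H : Finset (Finset α)} {B B' : Finset α} (hl : Lam H)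
    (hH : ∀ A ∈ H, x ∉ A) (hB : B ∈ H) (h : ins x H B = ins x H B') :
    B = B' := by
  have h1 : B ∈ ins x H B := (mem_ins_of_notMem (hH _ hB)).2 ⟨hB, fun h => h.2 subset_rfl⟩
  have h2 : insert x B ∈ ins x H B :=
    (insert_mem_ins (hH _ hB) hH (hl.1 _ hB)).2 ⟨hB, subset_rfl⟩
  rw [h, mem_ins_of_notMem (hH _ hB)] at h1
  rw [h, insert_mem_ins (hH _ hB) hH (hl.1 _ hB)] at h2
  by_contra hne
  exact h1.2 (Finset.ssubset_iff_subset_ne.2 ⟨h2.2, fun h => hne h.symm⟩)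

theorem ins_card {x : α} {H : Finset (Finset α)} {B : Finset α} (hl : Lam H)
    (hH : ∀ A ∈ H, x ∉ A) (hB : B ∈ H) : (ins x H B).card = H.card + 2 := by
  unfold ins
  rw [Finset.card_union_of_disjoint, Finset.card_union_of_disjoint, Finset.card_image_of_injOn]
  · have h1 : H.filter (fun C => B ⊆ C) = insert B (H.filter (fun C => B ⊂ C)) := by
      ext C
      simp only [Finset.mem_filter, Finset.mem_insert]
      constructor
      · rintro ⟨h, h'⟩
        rcases eq_or_ne B C with rfl | hne
        · exact Or.inl rfl
        · exact Or.inr ⟨h, Finset.ssubset_iff_subset_ne.2 ⟨h', hne⟩⟩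
      · rintro (rfl | h)
        · exact ⟨hB, subset_rfl⟩
        · exact ⟨h.1, h.2.1⟩
    rw [h1, Finset.card_insert_of_notMem (by simp)]
    have := Finset.card_filter_add_card_filter_not (s := H) (fun C => B ⊂ C)
    simp only [Finset.card_singleton]
    omega
  · intro C hC D hD h
    simp only [Finset.coe_filter, Set.mem_ofPred_eq] at hC hD
    simp only at h
    rw [← Finset.erase_insert (hH _ hC.1), h, Finset.erase_insert (hH _ hD.1)]
  · rw [Finset.disjoint_left]
    intro C hC hC'
    rw [Finset.mem_image] at hC'
    obtain ⟨D, hD, rfl⟩ := hC'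
    exact hH _ (Finset.mem_filter.1 hC).1 (Finset.mem_insert_self _ _)
  · rw [Finset.disjoint_singleton_right, Finset.mem_union, not_or]
    constructor
    · intro h
      exact hH _ (Finset.mem_filter.1 h).1 (Finset.mem_singleton_self _)
    · intro h
      obtain ⟨D, hD, h⟩ := Finset.mem_image.1 h
      have hD := (Finset.mem_filter.1 hD).1
      have : D = ∅ := by
        rw [← Finset.erase_insert (hH _ hD), h]; simp
      have := hl.1 _ hD
      simp_all

theorem ins_lam {x : α} {H : Finset (Finset α)} {B : Finset α} (hl : Lam H)
    (hH : ∀ A ∈ H, x ∉ A) (hB : B ∈ H) : Lam (ins x H B) := by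
  constructor
  · intro A hA
    rcases mem_ins.1 hA with h | ⟨D, -, -, rfl⟩ | rfl
    · exact hl.1 _ h.1
    · exact Finset.insert_nonempty _ _
    · simp
  · have hsing : ∀ A, Compat A {x} := by
      intro A
      by_cases h : x ∈ A
      · right; left; simpa using h
      · right; right; simpa using h
    have hmix : ∀ A D, A ∈ H → ¬ B ⊂ A → D ∈ H → B ⊆ D → Compat A (insert x D) := by
      intro A D hA hBA hD hBD
      rcases hl.2 _ hA _ hD with h | h | h
      · exact Or.inl (h.trans (Finset.subset_insert _ _))
      · rcases eq_or_ne B A with rfl | hne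
        · exact Or.inl (hBD.trans (Finset.subset_insert _ _))
        · exact absurd (Finset.ssubset_iff_subset_ne.2 ⟨hBD.trans h, hne⟩) hBA
      · right; right
        rw [Finset.disjoint_insert_right]
        exact ⟨hH _ hA, h⟩
    intro A hA C hC
    rcases mem_ins.1 hA with h | ⟨D, hD, hBD, rfl⟩ | rfl
    · rcases mem_ins.1 hC with h' | ⟨E, hE, hBE, rfl⟩ | rfl
      · exact hl.2 _ h.1 _ h'.1
      · exact hmix _ _ h.1 h.2 hE hBE
      · exact hsing _
    · rcases mem_ins.1 hC with h' | ⟨E, hE, hBE, rfl⟩ | rfl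
      · exact (hmix _ _ h'.1 h'.2 hD hBD).symm
      · obtain ⟨i, hi⟩ := hl.1 _ hB
        rcases (hl.2 _ hD _ hE).nested (hBD hi) (hBE hi) with h | h
        · exact Or.inl (Finset.insert_subset_insert _ h)
        · exact Or.inr (Or.inl (Finset.insert_subset_insert _ h))
      · exact hsing _
    · exact (hsing _).symm

theorem Hier.notMem {X : Finset α} {H : Finset (Finset α)} (hH : H ∈ Hier X) {x : α} (hx : x ∉ X) :
    ∀ A ∈ H, x ∉ A := fun A hA h => hx ((mem_Hier.1 hH).1 A hA h)

theorem ins_mem {x : α} {X : Finset α} (hx : x ∉ X) {H : Finset (Finset α)} {B : Finset α}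
    (hH : H ∈ Hier X) (hB : B ∈ H) : ins x H B ∈ Hier (insert x X) := by
  have hn := Hier.notMem hH hx
  obtain ⟨h1, h2, h3⟩ := mem_Hier.1 hH
  rw [mem_Hier]
  refine ⟨?_, ins_lam h2 hn hB, ?_⟩
  · intro A hA
    rcases mem_ins.1 hA with h | ⟨D, hD, -, rfl⟩ | rfl
    · exact (h1 _ h.1).trans (Finset.subset_insert _ _)
    · exact Finset.insert_subset_insert _ (h1 _ hD)
    · simp
  · rw [ins_card h2 hn hB, Finset.card_insert_of_notMem hx]
    omega

theorem exists_ins {x : α} {X : Finset α} (hx : x ∉ X) (hX : X.Nonempty) {H : Finset (Finset α)}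
    (hH : H ∈ Hier (insert x X)) : restr x H ∈ Hier X ∧ ∃ B ∈ restr x H, ins x (restr x H) B = H := by
  obtain ⟨h1, h2, h3⟩ := mem_Hier.1 hH
  have hl0 := h2.restr x
  have hs0 := restr_subset h1
  have hle := hl0.card_le hX hs0
  rw [Finset.card_insert_of_notMem hx] at h3
  have hst := card_step h2 x
  have hmem : restr x H ∈ Hier X := by
    rw [mem_Hier]
    exact ⟨hs0, hl0, by rcases hst with h | h <;> omega⟩
  refine ⟨hmem, ?_⟩
  have hn := Hier.notMem hmem hx
  obtain ⟨B, hB, hxB, hB1⟩ : ∃ B ∈ H, x ∉ B ∧ insert x B ∈ H := by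
    rcases hst with h | h
    · exact h.1
    · omega
  have hBr : B ∈ restr x H := mem_restr.2 ⟨h2.1 _ hB, hxB, Or.inl hB⟩
  refine ⟨B, hBr, ?_⟩
  symm
  apply Finset.eq_of_subset_of_card_le
  · intro C hC
    obtain ⟨b, hb⟩ := h2.1 _ hB
    by_cases hxC : x ∈ C
    · by_cases hCe : (C.erase x).Nonempty
      · rw [← Finset.insert_erase hxC]
        rw [insert_mem_ins (Finset.notMem_erase _ _) hn hCe]
        have hCr : C.erase x ∈ restr x H :=
          mem_restr.2 ⟨hCe, Finset.notMem_erase _ _, Or.inr (by rwa [Finset.insert_erase hxC])⟩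
        refine ⟨hCr, ?_⟩
        rw [Finset.subset_erase]
        refine ⟨?_, hxB⟩
        rcases (h2.2 _ hC _ hB1).nested hxC (Finset.mem_insert_self _ _) with h | h
        · obtain ⟨c, hc⟩ := hCe
          rw [Finset.mem_erase] at hc
          have hcB : c ∈ B := (Finset.mem_insert.1 (h hc.2)).resolve_left hc.1
          rcases (h2.2 _ hC _ hB).nested hc.2 hcB with h | h
          · exact absurd (h hxC) hxB
          · exact h
        · exact (Finset.subset_insert _ _).trans h
      · rw [Finset.not_nonempty_iff_eq_empty] at hCe
        have : C = {x} := by rw [← Finset.insert_erase hxC, hCe]; rfl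
        rw [mem_ins]
        exact Or.inr (Or.inr this)
    · rw [mem_ins_of_notMem hxC]
      refine ⟨mem_restr.2 ⟨h2.1 _ hC, hxC, Or.inl hC⟩, ?_⟩
      intro hBC
      rcases (h2.2 _ hC _ hB1).nested (hBC.1 hb) (Finset.mem_insert_of_mem hb) with h | h
      · apply hBC.2
        exact (Finset.subset_insert_iff_of_notMem hxC).1 h
      · exact hxC (h (Finset.mem_insert_self _ _))
  · rw [ins_card hl0 hn hBr]
    rcases hst with h | h <;> omega

theorem card_Hier_insert {x : α} {X : Finset α} (hx : x ∉ X) (hX : X.Nonempty)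
    (Q : Finset (Finset α) → Prop) [DecidablePred Q] :
    ((Hier (insert x X)).filter Q).card =
      ∑ H ∈ Hier X, (H.filter (fun B => Q (ins x H B))).card := by
  rw [Finset.card_eq_sum_card_fiberwise (f := restr x) (t := Hier X)]
  · apply Finset.sum_congr rfl
    intro H hH
    have hn := Hier.notMem hH hx
    obtain ⟨h1, h2, h3⟩ := mem_Hier.1 hH
    symm
    apply Finset.card_bij (fun B _ => ins x H B)
    · intro B hB
      rw [Finset.mem_filter] at hB
      rw [Finset.mem_filter, Finset.mem_filter]
      exact ⟨⟨ins_mem hx hH hB.1, hB.2⟩, restr_ins h2 hn⟩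
    · intro B hB B' hB' h
      exact ins_inj h2 hn (Finset.mem_filter.1 hB).1 h
    · intro H' hH'
      rw [Finset.mem_filter, Finset.mem_filter] at hH'
      obtain ⟨⟨ha, hb⟩, rfl⟩ := hH'
      obtain ⟨-, B, hB, he⟩ := exists_ins hx hX ha
      refine ⟨B, ?_, he⟩
      rw [Finset.mem_filter, he]
      exact ⟨hB, hb⟩
  · intro H hH
    have hH : H ∈ (Hier (insert x X)).filter Q := hH
    exact (exists_ins hx hX (Finset.mem_filter.1 hH).1).1

def hh (m : ℕ) : ℕ := numBPT (m + 1)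

theorem hh_one : hh 1 = 1 := by
  simp [hh, numBPT]

theorem hh_two : hh 2 = 1 := by
  simp [hh, numBPT]

theorem hh_succ (m : ℕ) (hm : 1 ≤ m) : hh (m + 1) = (2 * m - 1) * hh m := by
  unfold hh numBPT
  rw [Finset.prod_Icc_succ_top (by omega), mul_comm]
  congr 1

theorem hh_pos (m : ℕ) : 0 < hh m := by
  unfold hh numBPT
  apply Finset.prod_pos
  intro i hi
  rw [Finset.mem_Icc] at hi
  omega

theorem Hier_singleton (a : α) : Hier ({a} : Finset α) = {{{a}}} := by
  ext H
  rw [Finset.mem_singleton]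
  constructor
  · intro h
    have ht := Hier.top h
    obtain ⟨h1, h2, h3⟩ := mem_Hier.1 h
    rw [Finset.card_singleton] at h3
    obtain ⟨b, hb⟩ := Finset.card_eq_one.1 (show H.card = 1 by omega)
    subst hb
    rw [Finset.mem_singleton] at ht
    rw [ht]
  · rintro rfl
    rw [mem_Hier]
    refine ⟨by simp, ⟨by simp, ?_⟩, by simp⟩
    intro A hA B hB
    rw [Finset.mem_singleton] at hA hB
    rw [hA, hB]
    exact Compat.refl _

theorem card_Hier {X : Finset α} (hX : X.Nonempty) : (Hier X).card = hh X.card := by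
  induction hX using Finset.Nonempty.cons_induction with
  | singleton a => rw [Hier_singleton]; simp [hh_one]
  | cons x X hx hX ih =>
    rw [Finset.cons_eq_insert]
    have := card_Hier_insert hx hX (fun _ => True)
    simp only [Finset.filter_true] at this
    rw [this, Finset.card_insert_of_notMem hx, hh_succ _ (Finset.card_pos.2 hX), ← ih,
      Finset.sum_congr rfl (g := fun _ => 2 * X.card - 1), Finset.sum_const, smul_eq_mul, mul_comm]
    intro H hH
    have := (mem_Hier.1 hH).2.2
    omega

theorem card_Hier_mem_le {A : Finset α} (hA : A.Nonempty) : ∀ {X : Finset α}, A ⊆ X →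
    ((Hier X).filter (fun H => A ∈ H)).card ≤ hh A.card * hh (X.card - A.card + 1) := by
  induction hA using Finset.Nonempty.cons_induction with
  | singleton a =>
    intro X hX
    have hn : X.Nonempty := ⟨a, by simpa using hX⟩
    refine (Finset.card_filter_le _ _).trans ?_
    have := Finset.card_pos.2 hn
    rw [card_Hier hn, Finset.card_singleton, hh_one, one_mul, Nat.sub_add_cancel this]
  | cons x A hx hA ih =>
    intro X hX
    rw [Finset.cons_eq_insert] at *
    have hxX : x ∈ X := hX (Finset.mem_insert_self _ _)
    obtain ⟨X0, hx0, rfl⟩ : ∃ X0, x ∉ X0 ∧ insert x X0 = X :=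
      ⟨X.erase x, Finset.notMem_erase _ _, Finset.insert_erase hxX⟩
    have hA0 : A ⊆ X0 := (Finset.insert_subset_insert_iff hx).1 hX
    rw [card_Hier_insert hx0 (hA.mono hA0)]
    have : ∀ H ∈ Hier X0, (H.filter (fun B => insert x A ∈ ins x H B)).card ≤
        if A ∈ H then 2 * A.card - 1 else 0 := by
      intro H hH
      have hn := Hier.notMem hH hx0
      obtain ⟨h1, h2, h3⟩ := mem_Hier.1 hH
      simp only [insert_mem_ins hx hn hA]
      split_ifs with h
      · have := Lam.card_le (F := H.filter (fun B => A ∈ H ∧ B ⊆ A)) hA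
          ⟨fun B hB => h2.1 _ (Finset.mem_filter.1 hB).1,
            fun B hB C hC => h2.2 _ (Finset.mem_filter.1 hB).1 _ (Finset.mem_filter.1 hC).1⟩
          (fun B hB => (Finset.mem_filter.1 hB).2.2)
        omega
      · simp [h]
    refine (Finset.sum_le_sum this).trans ?_
    rw [← Finset.sum_filter, Finset.sum_const, smul_eq_mul]
    rw [Finset.card_insert_of_notMem hx, Finset.card_insert_of_notMem hx0,
      hh_succ _ (Finset.card_pos.2 hA), Nat.add_sub_add_right]
    calc _ ≤ (hh A.card * hh (X0.card - A.card + 1)) * (2 * A.card - 1) :=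
          Nat.mul_le_mul_right _ (ih hA0)
      _ = _ := by ring

theorem card_Hier_pairs (K : Finset (Finset α)) : ∀ {X : Finset α}, X.Nonempty →
    (∀ P ∈ K, P ⊆ X ∧ P.card = 2) → (∀ P ∈ K, ∀ Q ∈ K, P ≠ Q → Disjoint P Q) →
    ((Hier X).filter (fun H => K ⊆ H)).card = hh (X.card - K.card) := by
  induction K using Finset.induction_on with
  | empty =>
    intro X hX _ _
    simp [card_Hier hX]
  | insert P K hP ih =>
    intro X hX h1 h2
    have hPX := h1 P (Finset.mem_insert_self _ _)
    obtain ⟨x, y, hxy, rfl⟩ := Finset.card_eq_two.1 hPX.2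
    have hxX : x ∈ X := hPX.1 (by simp)
    have hyX : y ∈ X := hPX.1 (by simp)
    obtain ⟨X0, hx0, rfl⟩ : ∃ X0, x ∉ X0 ∧ insert x X0 = X :=
      ⟨X.erase x, Finset.notMem_erase _ _, Finset.insert_erase hxX⟩
    have hy0 : y ∈ X0 := (Finset.mem_insert.1 hyX).resolve_left (Ne.symm hxy)
    have hd : ∀ Q ∈ K, x ∉ Q ∧ y ∉ Q := by
      intro Q hQ
      have := h2 {x, y} (Finset.mem_insert_self _ _) Q (Finset.mem_insert_of_mem hQ)
        (fun h => hP (h ▸ hQ))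
      simpa using this
    have ih' := ih (X := X0) ⟨y, hy0⟩ (by
      intro Q hQ
      have := h1 Q (Finset.mem_insert_of_mem hQ)
      exact ⟨(Finset.subset_insert_iff_of_notMem (hd Q hQ).1).1 this.1, this.2⟩)
      (fun P hP Q hQ => h2 P (Finset.mem_insert_of_mem hP) Q (Finset.mem_insert_of_mem hQ))
    rw [card_Hier_insert hx0 ⟨y, hy0⟩, Finset.card_insert_of_notMem hx0,
      Finset.card_insert_of_notMem hP, Nat.add_sub_add_right, ← ih', Finset.card_filter]
    apply Finset.sum_congr rfl
    intro H hH
    have hn := Hier.notMem hH hx0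
    have hs := Hier.single hH hy0
    obtain ⟨g1, g2, g3⟩ := mem_Hier.1 hH
    have key : ∀ B ∈ H, insert {x, y} K ⊆ ins x H B ↔ (B = {y} ∧ K ⊆ H) := by
      intro B hB
      rw [Finset.insert_subset_iff]
      have e1 : ({x, y} : Finset α) ∈ ins x H B ↔ B = {y} := by
        rw [insert_mem_ins (by simpa using hxy) hn (by simp)]
        rw [Finset.subset_singleton_iff]
        constructor
        · rintro ⟨-, h | h⟩
          · exact absurd h (g2.1 _ hB).ne_empty
          · exact h
        · intro h; exact ⟨hs, Or.inr h⟩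
      rw [e1]
      apply and_congr_right
      rintro rfl
      constructor
      · intro h Q hQ
        exact ((mem_ins_of_notMem (hd Q hQ).1).1 (h hQ)).1
      · intro h Q hQ
        refine (mem_ins_of_notMem (hd Q hQ).1).2 ⟨h hQ, ?_⟩
        intro h'
        exact (hd Q hQ).2 (h'.1 (by simp))
    rw [Finset.filter_congr key]
    split_ifs with h
    · rw [Finset.card_eq_one]
      refine ⟨{y}, ?_⟩
      ext B
      simp only [Finset.mem_filter, Finset.mem_singleton]
      constructor
      · exact fun h => h.2.1
      · rintro rfl; exact ⟨hs, rfl, h⟩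
    · simp [h]

end Counting

section Rooted
set_option linter.unusedSectionVars false
variable {V : Type}

structure IsPar (G : SimpleGraph V) (ρ : V) (p : V → V) (d : V → ℕ) : Prop where
  root : p ρ = ρ
  lt : ∀ v, v ≠ ρ → d (p v) < d v
  adj : ∀ v w, G.Adj v w ↔ v ≠ w ∧ (p v = w ∨ p w = v)

def Anc (p : V → V) (v u : V) : Prop := ∃ k : ℕ, p^[k] u = v

theorem Anc.refl (p : V → V) (v : V) : Anc p v v := ⟨0, rfl⟩

theorem Anc.of_p {p : V → V} {v u : V} (h : Anc p v (p u)) : Anc p v u := by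
  obtain ⟨k, hk⟩ := h
  exact ⟨k + 1, hk⟩

theorem Anc.p_self (p : V → V) (v : V) : Anc p (p v) v := (Anc.refl p _).of_p

theorem Anc.cases {p : V → V} {v u : V} (h : Anc p v u) : u = v ∨ Anc p v (p u) := by
  obtain ⟨k, hk⟩ := h
  cases k with
  | zero => exact Or.inl hk
  | succ k => exact Or.inr ⟨k, hk⟩

theorem Anc.trans {p : V → V} {v u w : V} (h : Anc p v u) (h' : Anc p u w) : Anc p v w := by
  obtain ⟨k, hk⟩ := h
  obtain ⟨l, hl⟩ := h'
  refine ⟨k + l, ?_⟩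
  rw [Function.iterate_add_apply, hl, hk]

theorem Anc.total {p : V → V} {v u w : V} (h : Anc p v u) (h' : Anc p w u) :
    Anc p v w ∨ Anc p w v := by
  obtain ⟨k, hk⟩ := h
  obtain ⟨l, hl⟩ := h'
  rcases le_total k l with h | h
  · right
    refine ⟨l - k, ?_⟩
    rw [← hk, ← Function.iterate_add_apply, Nat.sub_add_cancel h, hl]
  · left
    refine ⟨k - l, ?_⟩
    rw [← hl, ← Function.iterate_add_apply, Nat.sub_add_cancel h, hk]

/-- an ancestor strictly above has a child on the way -/
theorem Anc.exists_child {p : V → V} {v u : V} (h : Anc p v u) (hne : v ≠ u) :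
    ∃ c, p c = v ∧ Anc p c u := by
  obtain ⟨k, hk⟩ := h
  cases k with
  | zero => exact absurd hk.symm hne
  | succ k =>
    rw [Function.iterate_succ_apply'] at hk
    exact ⟨_, hk, k, rfl⟩

namespace IsPar
variable {G : SimpleGraph V} {ρ : V} {p : V → V} {d : V → ℕ}

theorem anc_root (h : IsPar G ρ p d) {v : V} (hv : Anc p v ρ) : v = ρ := by
  obtain ⟨k, hk⟩ := hv
  rw [Function.iterate_fixed h.root] at hk
  exact hk.symm

theorem p_le (h : IsPar G ρ p d) (v : V) : d (p v) ≤ d v := by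
  by_cases hv : v = ρ
  · rw [hv, h.root]
  · exact (h.lt v hv).le

theorem d_le (h : IsPar G ρ p d) {v u : V} (hv : Anc p v u) : d v ≤ d u := by
  obtain ⟨k, rfl⟩ := hv
  induction k with
  | zero => exact le_rfl
  | succ k ih =>
    rw [Function.iterate_succ_apply']
    exact (h.p_le _).trans ih

theorem root_anc (h : IsPar G ρ p d) (u : V) : Anc p ρ u := by
  induction hn : d u using Nat.strong_induction_on generalizing u with
  | _ n ih =>
    by_cases hu : u = ρ
    · rw [hu]; exact Anc.refl _ _
    · exact (ih _ (hn ▸ h.lt u hu) (p u) rfl).of_p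

theorem not_anc_p (h : IsPar G ρ p d) {v : V} (hv : v ≠ ρ) : ¬ Anc p v (p v) := by
  intro h'
  have := h.d_le h'
  have := h.lt v hv
  omega

theorem p_ne (h : IsPar G ρ p d) {v : V} (hv : v ≠ ρ) : p v ≠ v := by
  intro h'
  have := h.lt v hv
  rw [h'] at this
  omega

theorem antisymm (h : IsPar G ρ p d) {v w : V} (h1 : Anc p v w) (h2 : Anc p w v) : v = w := by
  by_cases hw : w = ρ
  · subst hw; exact h.anc_root h1
  rcases h1.cases with h3 | h3
  · exact h3.symm
  · exact absurd (h2.trans h3) (h.not_anc_p hw)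

theorem adj_p (h : IsPar G ρ p d) {v : V} (hv : v ≠ ρ) : G.Adj v (p v) :=
  (h.adj _ _).2 ⟨(h.p_ne hv).symm, Or.inl rfl⟩

theorem mem_edge (h : IsPar G ρ p d) (e : Sym2 V) :
    e ∈ G.edgeSet ↔ ∃ v, v ≠ ρ ∧ s(v, p v) = e := by
  constructor
  · induction e with
    | _ a b =>
    intro he
    rw [SimpleGraph.mem_edgeSet, h.adj] at he
    obtain ⟨hne, rfl | rfl⟩ := he
    · exact ⟨a, fun h' => hne (by rw [h', h.root]), rfl⟩
    · exact ⟨b, fun h' => hne (by rw [h', h.root]), Sym2.eq_swap⟩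
  · rintro ⟨v, hv, rfl⟩
    exact h.adj_p hv

theorem edge_inj (h : IsPar G ρ p d) {v w : V} (hv : v ≠ ρ) (hw : w ≠ ρ)
    (he : s(v, p v) = s(w, p w)) : v = w := by
  rw [Sym2.eq_iff] at he
  rcases he with he | he
  · exact he.1
  · exfalso
    have h1 := h.lt v hv
    have h2 := h.lt w hw
    rw [he.2] at h1
    rw [← he.1] at h2
    omega

theorem reach_up (h : IsPar G ρ p d) {v : V} (hv : v ≠ ρ) {a : V} (ha : a ≠ v) :
    (G.deleteEdges {s(v, p v)}).Reachable a (p a) := by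
  by_cases har : a = ρ
  · rw [har, h.root]
  apply SimpleGraph.Adj.reachable
  rw [SimpleGraph.deleteEdges_adj]
  refine ⟨h.adj_p har, ?_⟩
  intro he
  exact ha (h.edge_inj har hv he)

theorem reach_anc (h : IsPar G ρ p d) {v : V} (hv : v ≠ ρ) {w u : V} (hw : Anc p w u)
    (hn : Anc p v u → Anc p v w) :
    (G.deleteEdges {s(v, p v)}).Reachable u w := by
  obtain ⟨k, hk⟩ := hw
  induction k generalizing u with
  | zero => rw [show u = w from hk]
  | succ k ih =>
    rw [Function.iterate_succ_apply] at hk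
    by_cases hu : u = v
    · subst hu
      have h1 := hn (Anc.refl _ _)
      have h2 : Anc p w u := ⟨k + 1, hk⟩
      rw [h.antisymm h1 h2]
    · exact (h.reach_up hv hu).trans (ih (fun h' => hn h'.of_p) hk)

theorem anc_adj (h : IsPar G ρ p d) {v : V} (hv : v ≠ ρ) {a b : V}
    (hab : (G.deleteEdges {s(v, p v)}).Adj a b) : Anc p v a ↔ Anc p v b := by
  rw [SimpleGraph.deleteEdges_adj, h.adj] at hab
  obtain ⟨⟨hne, hab⟩, he⟩ := hab
  have key : ∀ a, s(a, p a) ≠ s(v, p v) → (Anc p v a ↔ Anc p v (p a)) := by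
    intro a ha
    constructor
    · intro h1
      rcases h1.cases with rfl | h2
      · exact absurd rfl ha
      · exact h2
    · exact Anc.of_p
  rcases hab with rfl | rfl
  · exact key _ he
  · refine (key _ ?_).symm
    rw [Sym2.eq_swap]; exact he

theorem reach_iff (h : IsPar G ρ p d) {v : V} (hv : v ≠ ρ) {a b : V} :
    (G.deleteEdges {s(v, p v)}).Reachable a b ↔ (Anc p v a ↔ Anc p v b) := by
  constructor
  · rintro ⟨w⟩
    induction w with
    | nil => rfl
    | cons hab _ ih => exact (h.anc_adj hv hab).trans ih
  · intro hab
    by_cases ha : Anc p v a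
    · exact (h.reach_anc hv ha (fun _ => Anc.refl _ _)).trans
        (h.reach_anc hv (hab.1 ha) (fun _ => Anc.refl _ _)).symm
    · exact (h.reach_anc hv (h.root_anc a) (fun h' => absurd h' ha)).trans
        (h.reach_anc hv (h.root_anc b) (fun h' => absurd (hab.2 h') ha)).symm

theorem isTree (h : IsPar G ρ p d) : G.IsTree := by
  rw [SimpleGraph.isTree_iff]
  constructor
  · have hr : ∀ u, G.Reachable u ρ := by
      intro u
      obtain ⟨k, hk⟩ := h.root_anc u
      induction k generalizing u with
      | zero => rw [show u = ρ from hk]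
      | succ k ih =>
        by_cases hu : u = ρ
        · rw [hu]
        · exact (h.adj_p hu).reachable.trans (ih _ hk)
    have : Nonempty V := ⟨ρ⟩
    exact ⟨fun a b => (hr a).trans (hr b).symm⟩
  · rw [SimpleGraph.isAcyclic_iff_forall_isBridge]
    intro e he
    obtain ⟨v, hv, rfl⟩ := (h.mem_edge e).1 he
    rw [SimpleGraph.isBridge_iff]
    intro h'
    have := (h.reach_iff hv).1 h'
    exact h.not_anc_p hv (this.1 (Anc.refl _ _))

end IsPar

theorem exists_isPar {G : SimpleGraph V} (hG : G.IsTree) (ρ : V) :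
    ∃ p d, IsPar G ρ p d := by
  have hex : ∀ v, ∃! q : G.Walk v ρ, q.IsPath := fun v => hG.existsUnique_path v ρ
  choose f hf hu using hex
  have hadj : ∀ v w, G.Adj v w → (f v).snd = w ∨ (f w).snd = v := by
    intro v w h
    by_cases hv : v ∈ (f w).support
    · right
      have hp := (hf w).takeUntil hv
      have h2 : (SimpleGraph.Walk.cons h.symm .nil : G.Walk w v).IsPath := by
        simp [h.ne']
      have := hG.2.path_unique ⟨_, hp⟩ ⟨_, h2⟩
      have h3 : (f w).takeUntil v hv = SimpleGraph.Walk.cons h.symm .nil := congrArg Subtype.val this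
      have h4 := (f w).take_spec hv
      rw [h3] at h4
      rw [← h4]
      simp
    · left
      have : (SimpleGraph.Walk.cons h (f w)).IsPath := by
        rw [SimpleGraph.Walk.cons_isPath_iff]; exact ⟨hf w, hv⟩
      rw [← hu v _ this]
      simp
  have hnil : ∀ v, v ≠ ρ → ¬ (f v).Nil := fun v hv => SimpleGraph.Walk.not_nil_of_ne hv
  refine ⟨fun v => (f v).snd, fun v => (f v).length, ?_, ?_, ?_⟩
  · have := hu ρ .nil (by simp)
    rw [← this]; rfl
  · intro v hv
    have := hu (f v).snd (f v).tail (hf v).tail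
    rw [← this]
    have := SimpleGraph.Walk.length_tail_add_one (hnil v hv)
    omega
  · intro v w
    constructor
    · intro h
      exact ⟨h.ne, hadj v w h⟩
    · rintro ⟨hne, h | h⟩
      · have hv : v ≠ ρ := by
          rintro rfl
          have := hu v .nil (by simp)
          rw [← this] at h
          exact hne h
        rw [← h]
        exact SimpleGraph.Walk.adj_snd (hnil v hv)
      · have hv : w ≠ ρ := by
          rintro rfl
          have := hu w .nil (by simp)
          rw [← this] at h
          exact hne h.symm
        rw [← h]
        exact (SimpleGraph.Walk.adj_snd (hnil w hv)).symm

noncomputable def kids [Fintype V] (ρ : V) (p : V → V) (v : V) : Finset V :=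
  Finset.univ.filter (fun c => c ≠ ρ ∧ p c = v)

noncomputable def clus [Fintype V] {n : ℕ} (p : V → V) (leaf : Fin n → V) (v : V) : Finset (Fin n) :=
  Finset.univ.filter (fun i => Anc p v (leaf i))

namespace IsPar
variable [Fintype V] {G : SimpleGraph V} {ρ : V} {p : V → V} {d : V → ℕ}

theorem degree_ne (h : IsPar G ρ p d) {v : V} (hv : v ≠ ρ) :
    G.degree v = (kids ρ p v).card + 1 := by
  rw [← SimpleGraph.card_neighborFinset_eq_degree]
  have : G.neighborFinset v = insert (p v) (kids ρ p v) := by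
    ext c
    simp only [SimpleGraph.mem_neighborFinset, Finset.mem_insert, kids, Finset.mem_filter,
      Finset.mem_univ, true_and]
    rw [h.adj]
    constructor
    · rintro ⟨h1, h2 | h2⟩
      · exact Or.inl h2.symm
      · right
        refine ⟨?_, h2⟩
        rintro rfl
        rw [h.root] at h2
        exact hv h2.symm
    · rintro (h1 | ⟨h1, h2⟩)
      · rw [h1]; exact ⟨(h.p_ne hv).symm, Or.inl rfl⟩
      · refine ⟨?_, Or.inr h2⟩
        rintro rfl
        exact h.p_ne hv h2
  rw [this, Finset.card_insert_of_notMem]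
  simp only [kids, Finset.mem_filter, Finset.mem_univ, true_and, not_and]
  intro h1 h2
  have := h.lt _ hv
  have := h.lt _ h1
  rw [h2] at this
  omega

theorem degree_root (h : IsPar G ρ p d) : G.degree ρ = (kids ρ p ρ).card := by
  rw [← SimpleGraph.card_neighborFinset_eq_degree]
  congr 1
  ext c
  simp only [SimpleGraph.mem_neighborFinset, kids, Finset.mem_filter,
      Finset.mem_univ, true_and]
  rw [h.adj, h.root]
  constructor
  · rintro ⟨h1, h2 | h2⟩
    · exact absurd h2 h1
    · exact ⟨fun h => h1 h.symm, h2⟩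
  · rintro ⟨h1, h2⟩
    exact ⟨fun h => h1 h.symm, Or.inr h2⟩

theorem splitOfEdge_eq (h : IsPar G ρ p d) {n : ℕ} (leaf : Fin n → V) {v : V} (hv : v ≠ ρ) :
    splitOfEdge n G leaf s(v, p v) = s(clus p leaf v, (clus p leaf v)ᶜ) := by
  unfold splitOfEdge
  rw [Sym2.map_mk]
  refine congrArg₂ (fun a b => s(a, b)) ?_ ?_
  · ext i
    simp only [Finset.mem_filter, Finset.mem_univ, true_and, clus]
    rw [h.reach_iff hv]
    simp [Anc.refl]
  · ext i
    simp only [Finset.mem_filter, Finset.mem_univ, true_and, clus, Finset.mem_compl]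
    rw [h.reach_iff hv]
    simp [h.not_anc_p hv]

theorem splitsOf_eq (h : IsPar G ρ p d) {n : ℕ} (leaf : Fin n → V) :
    splitsOf n G leaf = ((Finset.univ.filter (fun v => v ≠ ρ)).image (clus p leaf)).image
      (fun A => s(A, Aᶜ)) := by
  ext σ
  unfold splitsOf
  simp only [Finset.mem_image, SimpleGraph.mem_edgeFinset, Finset.mem_filter, Finset.mem_univ,
    true_and, exists_exists_and_eq_and]
  constructor
  · rintro ⟨e, he, rfl⟩
    obtain ⟨v, hv, rfl⟩ := (h.mem_edge e).1 he
    exact ⟨v, hv, (h.splitOfEdge_eq leaf hv).symm⟩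
  · rintro ⟨v, hv, rfl⟩
    exact ⟨s(v, p v), (h.mem_edge _).2 ⟨v, hv, rfl⟩, h.splitOfEdge_eq leaf hv⟩

end IsPar
end Rooted

section GraphToHier
variable {V : Type} [Fintype V] {n : ℕ} {G : SimpleGraph V} {leaf : Fin n → V} {r : Fin n}
  {p : V → V} {d : V → ℕ}

theorem mem_kids {ρ : V} {p : V → V} {v c : V} : c ∈ kids ρ p v ↔ c ≠ ρ ∧ p c = v := by
  simp [kids]

theorem mem_clus {p : V → V} {v : V} {i : Fin n} : i ∈ clus p leaf v ↔ Anc p v (leaf i) := by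
  simp [clus]

theorem g_leaf_kids (hB : IsBinaryPhylo n G leaf) (hP : IsPar G (leaf r) p d) {i : Fin n}
    (hi : i ≠ r) : kids (leaf r) p (leaf i) = ∅ := by
  have h1 := hB.2.2.1 i
  rw [hP.degree_ne (fun h => hi (hB.2.1 h))] at h1
  rw [← Finset.card_eq_zero]; omega

theorem g_int_kids (hB : IsBinaryPhylo n G leaf) (hP : IsPar G (leaf r) p d) {v : V}
    (hv : v ∉ Set.range leaf) : (kids (leaf r) p v).card = 2 := by
  have h1 := hB.2.2.2 v hv
  rw [hP.degree_ne (fun h => hv ⟨r, h.symm⟩)] at h1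
  omega

theorem g_root_kids (hB : IsBinaryPhylo n G leaf) (hP : IsPar G (leaf r) p d) :
    (kids (leaf r) p (leaf r)).card = 1 := by
  have h1 := hB.2.2.1 r
  rwa [hP.degree_root] at h1

theorem g_anc_leaf (hB : IsBinaryPhylo n G leaf) (hP : IsPar G (leaf r) p d) {i : Fin n}
    (hi : i ≠ r) {u : V} (hu : Anc p (leaf i) u) : u = leaf i := by
  by_contra hne
  obtain ⟨c, hc, -⟩ := hu.exists_child (fun h => hne h.symm)
  have : c ∈ kids (leaf r) p (leaf i) := by
    rw [mem_kids]
    refine ⟨?_, hc⟩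
    rintro rfl
    rw [hP.root] at hc
    exact hi (hB.2.1 hc.symm)
  rw [g_leaf_kids hB hP hi] at this
  simp at this

theorem g_clus_leaf (hB : IsBinaryPhylo n G leaf) (hP : IsPar G (leaf r) p d) {i : Fin n}
    (hi : i ≠ r) : clus p leaf (leaf i) = {i} := by
  ext j
  rw [mem_clus, Finset.mem_singleton]
  constructor
  · intro h
    exact hB.2.1 (g_anc_leaf hB hP hi h)
  · rintro rfl
    exact Anc.refl _ _

theorem g_clus_nonempty (hB : IsBinaryPhylo n G leaf) (hP : IsPar G (leaf r) p d) (v : V) :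
    (clus p leaf v).Nonempty := by
  obtain ⟨u, hu, hmax⟩ := Finset.exists_max_image (Finset.univ.filter (fun u => Anc p v u)) d
    ⟨v, by simp [Anc.refl]⟩
  simp only [Finset.mem_filter, Finset.mem_univ, true_and] at hu hmax
  by_cases hr : u ∈ Set.range leaf
  · obtain ⟨i, rfl⟩ := hr
    exact ⟨i, mem_clus.2 hu⟩
  · have h2 := g_int_kids hB hP hr
    obtain ⟨c, hc⟩ := Finset.card_pos.1 (by omega : 0 < (kids (leaf r) p u).card)
    rw [mem_kids] at hc
    have h3 := hmax c (Anc.of_p (by rw [hc.2]; exact hu))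
    have h4 := hP.lt c hc.1
    rw [hc.2] at h4
    omega

theorem g_kid_subset {v c : V} (hc : p c = v) : clus p leaf c ⊆ clus p leaf v := by
  intro i hi
  rw [mem_clus] at hi ⊢
  refine Anc.trans ?_ hi
  rw [← hc]; exact Anc.p_self _ _

theorem g_kid_disjoint (hP : IsPar G (leaf r) p d) {v c c' : V} (hc : c ∈ kids (leaf r) p v)
    (hc' : c' ∈ kids (leaf r) p v) (hne : c ≠ c') : Disjoint (clus p leaf c) (clus p leaf c') := by
  rw [Finset.disjoint_left]
  have key : ∀ {c c' : V}, c ∈ kids (leaf r) p v → c' ∈ kids (leaf r) p v → c ≠ c' →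
      ¬ Anc p c c' := by
    intro c c' hc hc' hne h
    rw [mem_kids] at hc hc'
    rcases h.cases with h | h
    · exact hne h.symm
    · rw [hc'.2, ← hc.2] at h
      exact hP.not_anc_p hc.1 h
  intro i hi hi'
  rw [mem_clus] at hi hi'
  rcases hi.total hi' with h | h
  · exact key hc hc' hne h
  · exact key hc' hc hne.symm h

theorem g_two_kids (hB : IsBinaryPhylo n G leaf) (hP : IsPar G (leaf r) p d) {v w : V}
    (hv : v ≠ leaf r) (hvw : Anc p v w) (hne : v ≠ w) : ¬ (clus p leaf v ⊆ clus p leaf w) := by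
  intro hs
  obtain ⟨c, hc, hcw⟩ := hvw.exists_child hne
  have hcr : c ≠ leaf r := by
    rintro rfl
    rw [hP.root] at hc
    exact hv hc.symm
  have hck : c ∈ kids (leaf r) p v := mem_kids.2 ⟨hcr, hc⟩
  have hvl : v ∉ Set.range leaf := by
    rintro ⟨i, rfl⟩
    rw [g_leaf_kids hB hP (fun h => hv (by rw [h]))] at hck
    simp at hck
  obtain ⟨c', hc', hcc⟩ := Finset.exists_mem_ne (by rw [g_int_kids hB hP hvl]; norm_num) c
  obtain ⟨i, hi⟩ := g_clus_nonempty hB hP c'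
  have h1 := hs (g_kid_subset (mem_kids.1 hc').2 hi)
  have h2 : i ∈ clus p leaf c := by
    rw [mem_clus] at h1 ⊢
    exact hcw.trans h1
  exact Finset.disjoint_left.1 (g_kid_disjoint hP hck hc' hcc.symm) h2 hi

theorem g_clus_inj (hB : IsBinaryPhylo n G leaf) (hP : IsPar G (leaf r) p d) {v w : V}
    (hv : v ≠ leaf r) (hw : w ≠ leaf r) (h : clus p leaf v = clus p leaf w) : v = w := by
  by_contra hne
  obtain ⟨i, hi⟩ := g_clus_nonempty hB hP v
  have hi' := h ▸ hi
  rw [mem_clus] at hi hi'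
  rcases hi.total hi' with h1 | h1
  · exact g_two_kids hB hP hv h1 hne h.subset
  · exact g_two_kids hB hP hw h1 (Ne.symm hne) h.symm.subset

theorem g_root_notMem (hP : IsPar G (leaf r) p d) {v : V}
    (hv : v ≠ leaf r) : r ∉ clus p leaf v := by
  intro h
  exact hv (hP.anc_root (mem_clus.1 h))

theorem g_card (hB : IsBinaryPhylo n G leaf) : Fintype.card V + 2 = 2 * n := by
  have h1 := hB.1.card_edgeFinset
  have h2 := G.sum_degrees_eq_twice_card_edges
  have h3 : ∑ v, G.degree v = ∑ v : V, if v ∈ Finset.univ.image leaf then 1 else 3 := by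
    apply Finset.sum_congr rfl
    intro v _
    split_ifs with h
    · rw [Finset.mem_image] at h
      obtain ⟨i, -, rfl⟩ := h
      exact hB.2.2.1 i
    · apply hB.2.2.2
      rintro ⟨i, rfl⟩
      simp at h
  have h4 : (Finset.univ.filter (fun v => v ∈ Finset.univ.image leaf)).card = n := by
    rw [Finset.filter_mem_eq_inter, Finset.univ_inter, Finset.card_image_of_injective _ hB.2.1]
    simp
  have h5 := Finset.card_filter_add_card_filter_not (s := (Finset.univ : Finset V))
    (fun v => v ∈ Finset.univ.image leaf)
  rw [Finset.sum_ite, Finset.sum_const, Finset.sum_const, smul_eq_mul, smul_eq_mul] at h3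
  rw [Finset.card_univ] at h5
  simp only [h4] at h3 h5
  have h6 : (G.edgeFinset).card + 1 = Fintype.card V := by convert h1
  have h7 : ∑ v, G.degree v = 2 * (G.edgeFinset).card := by convert h2
  omega

noncomputable def treeH (p : V → V) (leaf : Fin n → V) (r : Fin n) : Finset (Finset (Fin n)) :=
  (Finset.univ.filter (fun v => v ≠ leaf r)).image (clus p leaf)

theorem mem_treeH {A : Finset (Fin n)} :
    A ∈ treeH p leaf r ↔ ∃ v, v ≠ leaf r ∧ clus p leaf v = A := by
  simp [treeH]

theorem treeH_mem (hB : IsBinaryPhylo n G leaf) (hP : IsPar G (leaf r) p d) :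
    treeH p leaf r ∈ Hier (Finset.univ.erase r) := by
  rw [mem_Hier]
  refine ⟨?_, ⟨?_, ?_⟩, ?_⟩
  · intro A hA
    obtain ⟨v, hv, rfl⟩ := mem_treeH.1 hA
    rw [Finset.subset_erase]
    exact ⟨Finset.subset_univ _, g_root_notMem hP hv⟩
  · intro A hA
    obtain ⟨v, hv, rfl⟩ := mem_treeH.1 hA
    exact g_clus_nonempty hB hP v
  · intro A hA B hB
    obtain ⟨v, hv, rfl⟩ := mem_treeH.1 hA
    obtain ⟨w, hw, rfl⟩ := mem_treeH.1 hB
    by_cases hd : Disjoint (clus p leaf v) (clus p leaf w)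
    · exact Or.inr (Or.inr hd)
    · rw [Finset.not_disjoint_iff] at hd
      obtain ⟨i, hi, hi'⟩ := hd
      rw [mem_clus] at hi hi'
      rcases hi.total hi' with h | h
      · right; left
        intro j hj
        rw [mem_clus] at hj ⊢
        exact h.trans hj
      · left
        intro j hj
        rw [mem_clus] at hj ⊢
        exact h.trans hj
  · unfold treeH
    rw [Finset.card_image_of_injOn, Finset.filter_ne', Finset.card_erase_of_mem (Finset.mem_univ _),
      Finset.card_erase_of_mem (Finset.mem_univ _), Finset.card_univ, Finset.card_univ,
      Fintype.card_fin]
    · have := g_card hB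
      have : 0 < n := Fin.pos r
      have : 0 < Fintype.card V := Fintype.card_pos_iff.2 ⟨leaf r⟩
      omega
    · intro v hv w hw h
      simp only [Finset.coe_filter, Finset.mem_univ, true_and, Set.mem_ofPred_eq] at hv hw
      exact g_clus_inj hB hP hv hw h

theorem toFinset_inj {β : Type} [DecidableEq β] {a b : Sym2 β} (h : a.toFinset = b.toFinset) :
    a = b := by
  apply Sym2.ext
  intro x
  rw [← Sym2.mem_toFinset, h, Sym2.mem_toFinset]

theorem mem_cherry (hB : IsBinaryPhylo n G leaf) (hP : IsPar G (leaf r) p d) {i j : Fin n}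
    (hij : i ≠ j) (hi : i ≠ r) (hj : j ≠ r) :
    (∃ v, G.Adj (leaf i) v ∧ G.Adj (leaf j) v) ↔ {i, j} ∈ treeH p leaf r := by
  have hl : ∀ {i : Fin n}, i ≠ r → leaf i ≠ leaf r := fun hi h => hi (hB.2.1 h)
  have hadj : ∀ {i : Fin n} {v : V}, i ≠ r → (G.Adj (leaf i) v ↔ p (leaf i) = v) := by
    intro i v hi
    constructor
    · intro h
      rcases ((hP.adj _ _).1 h) with ⟨h1, h2 | h2⟩
      · exact h2
      · exfalso
        apply h1
        exact (g_anc_leaf hB hP hi ⟨1, h2⟩).symm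
    · rintro rfl
      exact hP.adj_p (hl hi)
  constructor
  · rintro ⟨v, h1, h2⟩
    rw [hadj hi] at h1
    rw [hadj hj] at h2
    have k1 : leaf i ∈ kids (leaf r) p v := mem_kids.2 ⟨hl hi, h1⟩
    have k2 : leaf j ∈ kids (leaf r) p v := mem_kids.2 ⟨hl hj, h2⟩
    have hne : leaf i ≠ leaf j := fun h => hij (hB.2.1 h)
    have hsub : {leaf i, leaf j} ⊆ kids (leaf r) p v := by
      intro x hx
      simp only [Finset.mem_insert, Finset.mem_singleton] at hx
      rcases hx with rfl | rfl
      · exact k1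
      · exact k2
    have hc := Finset.card_le_card hsub
    rw [Finset.card_pair hne] at hc
    have hvl : v ∉ Set.range leaf := by
      rintro ⟨k, rfl⟩
      by_cases hk : k = r
      · subst hk
        rw [g_root_kids hB hP] at hc
        omega
      · rw [g_leaf_kids hB hP hk] at hc
        simp at hc
    have hkids : kids (leaf r) p v = {leaf i, leaf j} := by
      symm
      apply Finset.eq_of_subset_of_card_le hsub
      rw [Finset.card_pair hne, g_int_kids hB hP hvl]
    rw [mem_treeH]
    refine ⟨v, fun h => hvl ⟨r, h.symm⟩, ?_⟩
    apply Finset.Subset.antisymm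
    · intro k hk
      rw [mem_clus] at hk
      obtain ⟨c, hc, hck⟩ := hk.exists_child (fun h => hvl ⟨k, h.symm⟩)
      have hcr : c ≠ leaf r := by
        rintro rfl
        rw [hP.root] at hc
        exact hvl ⟨r, hc⟩
      have : c ∈ kids (leaf r) p v := mem_kids.2 ⟨hcr, hc⟩
      rw [hkids, Finset.mem_insert, Finset.mem_singleton] at this
      rw [Finset.mem_insert, Finset.mem_singleton]
      rcases this with rfl | rfl
      · exact Or.inl (hB.2.1 (g_anc_leaf hB hP hi hck))
      · exact Or.inr (hB.2.1 (g_anc_leaf hB hP hj hck))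
    · intro k hk
      rw [Finset.mem_insert, Finset.mem_singleton] at hk
      rw [mem_clus]
      rcases hk with rfl | rfl
      · rw [← h1]; exact Anc.p_self _ _
      · rw [← h2]; exact Anc.p_self _ _
  · intro h
    obtain ⟨v, hv, hc⟩ := mem_treeH.1 h
    have hvl : v ∉ Set.range leaf := by
      rintro ⟨k, rfl⟩
      rw [g_clus_leaf hB hP (fun h => hv (by rw [h]))] at hc
      have := congrArg Finset.card hc
      rw [Finset.card_pair hij, Finset.card_singleton] at this
      omega
    -- each of leaf i, leaf j is a child
    have key : ∀ {i j : Fin n}, i ≠ j → i ≠ r → clus p leaf v = {i, j} → p (leaf i) = v := by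
      intro i j hij hi hc
      have h1 : Anc p v (leaf i) := mem_clus.1 (by rw [hc]; simp)
      obtain ⟨c, hc1, hc2⟩ := h1.exists_child (fun h => hvl ⟨i, h.symm⟩)
      have hcr : c ≠ leaf r := by
        rintro rfl
        rw [hP.root] at hc1
        exact hvl ⟨r, hc1⟩
      have hvc : Anc p v c := by rw [← hc1]; exact Anc.p_self _ _
      have hne : v ≠ c := by rintro rfl; exact hP.p_ne hcr hc1
      have hns := g_two_kids hB hP hv hvc hne
      have hcc : clus p leaf c = {i} := by
        have hs := g_kid_subset (leaf := leaf) hc1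
        ext k
        rw [Finset.mem_singleton]
        constructor
        · intro hk
          have := hs hk
          rw [hc, Finset.mem_insert, Finset.mem_singleton] at this
          rcases this with h | rfl
          · exact h
          · exfalso
            apply hns
            rw [hc]
            intro l hl
            rw [Finset.mem_insert, Finset.mem_singleton] at hl
            rcases hl with rfl | rfl
            · exact mem_clus.2 hc2
            · exact hk
        · rintro rfl; exact mem_clus.2 hc2
      have := g_clus_inj hB hP hcr (hl hi) (by rw [hcc, g_clus_leaf hB hP hi])
      rw [← this]; exact hc1
    refine ⟨v, (hadj hi).2 (key hij hi hc), (hadj hj).2 (key hij.symm hj ?_)⟩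
    rw [hc, Finset.pair_comm]

theorem cherries_ge (hB : IsBinaryPhylo n G leaf) (hP : IsPar G (leaf r) p d) :
    ((treeH p leaf r).filter (fun A => A.card = 2)).card ≤ numCherries n G leaf := by
  unfold numCherries
  refine le_trans (Finset.card_le_card ?_) (Finset.card_image_le (f := fun q : Sym2 (Fin n) => q.toFinset))
  intro A hA
  rw [Finset.mem_filter] at hA
  obtain ⟨i, j, hij, rfl⟩ := Finset.card_eq_two.1 hA.2
  have hs := (mem_Hier.1 (treeH_mem hB hP)).1 _ hA.1
  have hi : i ≠ r := Finset.ne_of_mem_erase (hs (by simp))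
  have hj : j ≠ r := Finset.ne_of_mem_erase (hs (by simp))
  rw [Finset.mem_image]
  refine ⟨s(i, j), ?_, by ext; simp⟩
  obtain ⟨v, h1, h2⟩ := (mem_cherry hB hP hij hi hj).2 hA.1
  simp only [Finset.mem_filter, Finset.mem_univ, true_and]
  refine ⟨by simpa using hij, v, ?_⟩
  intro k hk
  rw [Sym2.mem_iff] at hk
  rcases hk with rfl | rfl
  · exact h1
  · exact h2

theorem cherries_le (hB : IsBinaryPhylo n G leaf) (hP : IsPar G (leaf r) p d) :
    numCherries n G leaf ≤ ((treeH p leaf r).filter (fun A => A.card = 2)).card + 3 := by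
  unfold numCherries
  rw [← Finset.card_filter_add_card_filter_not (fun q : Sym2 (Fin n) => r ∉ q)]
  apply Nat.add_le_add
  · apply Finset.card_le_card_of_injOn (fun q => q.toFinset)
    · intro q hq
      induction q with
      | _ i j =>
      simp only [Finset.coe_filter, Finset.mem_filter, Finset.mem_univ, true_and, Set.mem_ofPred_eq,
        Sym2.mem_iff, not_or, Sym2.mk_isDiag_iff] at hq
      obtain ⟨⟨hij, v, hv⟩, h1, h2⟩ := hq
      have := (mem_cherry hB hP hij (Ne.symm h1) (Ne.symm h2)).1 ⟨v, hv i (Or.inl rfl), hv j (Or.inr rfl)⟩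
      have he : (s(i, j)).toFinset = {i, j} := by ext; simp
      simp only [Finset.coe_filter, Set.mem_ofPred_eq]
      rw [he]
      exact ⟨this, Finset.card_pair hij⟩
    · intro a _ b _ h
      exact toFinset_inj h
  · have h1 := hB.2.2.1 r
    rw [← SimpleGraph.card_neighborFinset_eq_degree] at h1
    obtain ⟨v0, hv0⟩ := Finset.card_eq_one.1 h1
    have hd : G.degree v0 ≤ 3 := by
      by_cases h : v0 ∈ Set.range leaf
      · obtain ⟨i, rfl⟩ := h
        rw [hB.2.2.1 i]; norm_num
      · rw [hB.2.2.2 v0 h]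
    rw [← SimpleGraph.card_neighborFinset_eq_degree] at hd
    refine le_trans ?_ hd
    have hN : (Finset.univ.filter (fun j => G.Adj (leaf j) v0)).card ≤ (G.neighborFinset v0).card := by
      apply Finset.card_le_card_of_injOn leaf
      · intro j hj
        simp only [Finset.coe_filter, Finset.mem_univ, true_and, Set.mem_ofPred_eq] at hj
        simpa using hj.symm
      · exact hB.2.1.injOn
    refine le_trans (le_trans (Finset.card_le_card ?_) (Finset.card_image_le (f := fun j => s(r, j)))) hN
    intro q hq
    simp only [Finset.mem_filter, Finset.mem_univ, true_and, not_not] at hq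
    obtain ⟨⟨hdg, v, hv⟩, hr⟩ := hq
    obtain ⟨j, rfl⟩ := hr
    rw [Finset.mem_image]
    refine ⟨j, ?_, rfl⟩
    have e : v = v0 := by
      have : v ∈ G.neighborFinset (leaf r) := by
        rw [SimpleGraph.mem_neighborFinset]; exact hv r (by simp)
      rw [hv0] at this
      simpa using this
    subst e
    simp only [Finset.mem_filter, Finset.mem_univ, true_and]
    exact hv j (by simp)

end GraphToHier

section HierToGraph

theorem realize_aux {n : ℕ} (hn : 2 ≤ n) {r : Fin n} {H : Finset (Finset (Fin n))}
    (hH : H ∈ Hier (Finset.univ.erase r)) {W : Type} [Fintype W] (leaf : Fin n → W)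
    (cl : W → Finset (Fin n)) (hinj : Function.Injective cl)
    (hmem : ∀ A, (∃ w, cl w = A) ↔ A = Finset.univ ∨ A ∈ H)
    (hroot : cl (leaf r) = Finset.univ) (hleaf : ∀ i, i ≠ r → cl (leaf i) = {i}) :
    ∃ G : SimpleGraph W, IsBinaryPhylo n G leaf ∧ splitsOf n G leaf = H.image (fun A => s(A, Aᶜ)) := by
  have hr := Hier.notMem hH (Finset.notMem_erase r _)
  obtain ⟨g1, g2, g3⟩ := mem_Hier.1 hH
  have hclH : ∀ w, w ≠ leaf r → cl w ∈ H := by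
    intro w hw
    rcases (hmem _).1 ⟨w, rfl⟩ with h | h
    · exact absurd (hinj (h.trans hroot.symm)) hw
    · exact h
  have hne : ∀ w, (cl w).Nonempty := by
    intro w
    rcases (hmem _).1 ⟨w, rfl⟩ with h | h
    · rw [h]; exact ⟨r, Finset.mem_univ _⟩
    · exact g2.1 _ h
  have hcomp : ∀ v w, Compat (cl v) (cl w) := by
    intro v w
    by_cases hv : v = leaf r
    · rw [hv, hroot]; exact Or.inr (Or.inl (Finset.subset_univ _))
    by_cases hw : w = leaf r
    · rw [hw, hroot]; exact Or.inl (Finset.subset_univ _)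
    exact g2.2 _ (hclH _ hv) _ (hclH _ hw)
  have huniv : ∀ w, w ≠ leaf r → r ∉ cl w := fun w hw => hr _ (hclH w hw)
  have hex : ∀ w, ∃ u, (w = leaf r → u = leaf r) ∧ (w ≠ leaf r → cl w ⊂ cl u ∧
      ∀ u', cl w ⊂ cl u' → cl u ⊆ cl u') := by
    intro w
    by_cases hw : w = leaf r
    · exact ⟨leaf r, fun _ => rfl, fun h => absurd hw h⟩
    · obtain ⟨u, hu, hmin⟩ := Finset.exists_min_image
        (Finset.univ.filter (fun u => cl w ⊂ cl u)) (fun u => (cl u).card) (by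
          refine ⟨leaf r, ?_⟩
          simp only [Finset.mem_filter, Finset.mem_univ, true_and]
          rw [hroot]
          refine Finset.ssubset_iff_subset_ne.2 ⟨Finset.subset_univ _, fun h => ?_⟩
          exact huniv w hw (by rw [h]; exact Finset.mem_univ _))
      simp only [Finset.mem_filter, Finset.mem_univ, true_and] at hu hmin
      refine ⟨u, fun h => absurd h hw, fun _ => ⟨hu, ?_⟩⟩
      intro u' hu'
      obtain ⟨i, hi⟩ := hne w
      rcases (hcomp u u').nested (hu.1 hi) (hu'.1 hi) with h | h
      · exact h
      · exact (Finset.eq_of_subset_of_card_le h (hmin u' hu')).symm.subset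
  choose p hp0 hp using hex
  let G : SimpleGraph W :=
    { Adj := fun v w => v ≠ w ∧ (p v = w ∨ p w = v)
      symm := ⟨fun v w h => ⟨h.1.symm, h.2.symm⟩⟩
      loopless := ⟨fun v h => h.1 rfl⟩ }
  have hP : IsPar G (leaf r) p (fun w => n - (cl w).card) := by
    refine ⟨hp0 _ rfl, ?_, fun v w => Iff.rfl⟩
    intro v hv
    have h1 := Finset.card_lt_card (hp v hv).1
    have h2 : (cl (p v)).card ≤ n := by simpa using Finset.card_le_univ (cl (p v))
    omega
  have hpsub : ∀ u, cl u ⊆ cl (p u) := by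
    intro u
    by_cases hu : u = leaf r
    · rw [hp0 u hu, hroot]; exact Finset.subset_univ _
    · exact (hp u hu).1.1
  have hanc1 : ∀ v u, Anc p v u → cl u ⊆ cl v := by
    rintro v u ⟨k, rfl⟩
    induction k generalizing u with
    | zero => exact subset_rfl
    | succ k ih => exact (hpsub u).trans (ih (p u))
  have hanc2 : ∀ m, ∀ v u, n - (cl u).card = m → cl u ⊆ cl v → Anc p v u := by
    intro m
    induction m using Nat.strong_induction_on with
    | _ m ih =>
      intro v u hm hs
      by_cases he : cl u = cl v
      · rw [hinj he]; exact Anc.refl _ _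
      have hss : cl u ⊂ cl v := Finset.ssubset_iff_subset_ne.2 ⟨hs, he⟩
      have hu : u ≠ leaf r := by
        rintro rfl
        rw [hroot] at hss
        exact hss.2 (Finset.subset_univ _)
      exact (ih _ (hm ▸ hP.lt u hu) v (p u) rfl ((hp u hu).2 v hss)).of_p
  have hanc : ∀ v u, Anc p v u ↔ cl u ⊆ cl v := fun v u => ⟨hanc1 v u, hanc2 _ v u rfl⟩
  have hleafinj : Function.Injective leaf := by
    intro i j hij
    have h := congrArg cl hij
    by_cases hi : i = r <;> by_cases hj : j = r
    · rw [hi, hj]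
    · exfalso
      subst hi
      apply huniv (leaf j)
      · intro h'
        rw [hroot, hleaf j hj] at h
        have := congrArg Finset.card h
        simp at this
        omega
      · rw [← h, hroot]; exact Finset.mem_univ _
    · exfalso
      subst hj
      apply huniv (leaf i)
      · intro h'
        rw [hroot, hleaf i hi] at h
        have := congrArg Finset.card h
        simp at this
        omega
      · rw [h, hroot]; exact Finset.mem_univ _
    · rw [hleaf i hi, hleaf j hj] at h
      simpa using h
  refine ⟨G, ⟨hP.isTree, hleafinj, ?_, ?_⟩, ?_⟩
  · intro i
    by_cases hi : i = r
    · subst hi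
      rw [hP.degree_root, Finset.card_eq_one]
      obtain ⟨t, ht⟩ := (hmem _).2 (Or.inr (Hier.top hH))
      refine ⟨t, ?_⟩
      have htr : t ≠ leaf i := by
        rintro rfl
        rw [hroot] at ht
        have : i ∈ (Finset.univ.erase i) := by rw [← ht]; exact Finset.mem_univ _
        simp at this
      ext c
      rw [mem_kids, Finset.mem_singleton]
      constructor
      · rintro ⟨h1, h2⟩
        by_contra hct
        have hs : cl c ⊂ cl t := by
          refine Finset.ssubset_iff_subset_ne.2 ⟨?_, fun h => hct (hinj h)⟩
          rw [ht]; exact g1 _ (hclH c h1)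
        have := (hp c h1).2 t hs
        rw [h2, hroot] at this
        exact huniv t htr (this (Finset.mem_univ _))
      · rintro rfl
        refine ⟨htr, ?_⟩
        by_contra hpc
        have h1 := (hp c htr).1
        have h2 := g1 _ (hclH _ hpc)
        rw [ht] at h1
        exact h1.2 h2
    · have hlr : leaf i ≠ leaf r := fun h => hi (hleafinj h)
      rw [hP.degree_ne hlr]
      suffices kids (leaf r) p (leaf i) = ∅ by rw [this]; rfl
      rw [Finset.eq_empty_iff_forall_notMem]
      intro c hc
      rw [mem_kids] at hc
      have h1 := (hp c hc.1).1
      rw [hc.2, hleaf i hi, Finset.ssubset_singleton_iff] at h1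
      exact (hne c).ne_empty h1
  · intro v hv
    have hvr : v ≠ leaf r := fun h => hv ⟨r, h.symm⟩
    rw [hP.degree_ne hvr]
    suffices (kids (leaf r) p v).card = 2 by rw [this]
    have hvH := hclH v hvr
    have h2 : 2 ≤ (cl v).card := by
      by_contra hlt
      have hpos := Finset.card_pos.2 (hne v)
      obtain ⟨i, hi⟩ := Finset.card_eq_one.1 (show (cl v).card = 1 by omega)
      have hir : i ≠ r := by
        rintro rfl
        exact huniv v hvr (by rw [hi]; simp)
      exact hv ⟨i, hinj (by rw [hleaf i hir, hi])⟩
    obtain ⟨B, hB, C, hC, hd, hu⟩ := Hier.children hH hvH h2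
    obtain ⟨b, rfl⟩ := (hmem _).2 (Or.inr hB)
    obtain ⟨c, rfl⟩ := (hmem _).2 (Or.inr hC)
    have key : ∀ b c, cl b ∈ H → cl c ∈ H → Disjoint (cl b) (cl c) → cl b ∪ cl c = cl v →
        b ≠ leaf r ∧ p b = v := by
      intro b c hb hc hd hu
      have hbr : b ≠ leaf r := by
        rintro rfl
        exact hr _ hb (by rw [hroot]; exact Finset.mem_univ _)
      refine ⟨hbr, ?_⟩
      obtain ⟨h1, h2⟩ := hp b hbr
      have hbv : cl b ⊂ cl v := by
        rw [← hu]
        refine ⟨Finset.subset_union_left, fun h => ?_⟩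
        obtain ⟨i, hi⟩ := hne c
        exact Finset.disjoint_left.1 hd (h (Finset.mem_union_right _ hi)) hi
      have h3 := h2 v hbv
      apply hinj
      refine Finset.Subset.antisymm h3 ?_
      rw [← hu] at h3 ⊢
      obtain ⟨i, hi, hib⟩ := Finset.exists_of_ssubset h1
      have hic := (Finset.mem_union.1 (h3 hi)).resolve_left hib
      rcases (hcomp (p b) c).nested hi hic with h | h
      · exfalso
        obtain ⟨j, hj⟩ := hne b
        exact Finset.disjoint_left.1 hd hj (h (h1.1 hj))
      · exact Finset.union_subset h1.1 h
    have kb := key b c hB hC hd hu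
    have kc := key c b hC hB hd.symm (by rw [Finset.union_comm, hu])
    have hbc : b ≠ c := by
      rintro rfl
      exact (hne b).ne_empty (disjoint_self.1 hd)
    have key2 : ∀ b x, b ≠ leaf r → p b = v → x ≠ leaf r → p x = v → ∀ i, i ∈ cl x → i ∈ cl b →
        x = b := by
      intro b x hb hpb hx hpx i hix hib
      by_contra hxb
      rcases (hcomp x b).nested hix hib with h | h
      · have := (hp x hx).2 b (Finset.ssubset_iff_subset_ne.2 ⟨h, fun h => hxb (hinj h)⟩)
        rw [hpx, ← hpb] at this
        exact (hp b hb).1.2 this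
      · have := (hp b hb).2 x (Finset.ssubset_iff_subset_ne.2 ⟨h, fun h => hxb (hinj h).symm⟩)
        rw [hpb, ← hpx] at this
        exact (hp x hx).1.2 this
    have : kids (leaf r) p v = {b, c} := by
      ext x
      rw [mem_kids, Finset.mem_insert, Finset.mem_singleton]
      constructor
      · rintro ⟨h1, h3⟩
        obtain ⟨i, hi⟩ := hne x
        have hiv := (hp x h1).1.1 hi
        rw [h3, ← hu, Finset.mem_union] at hiv
        rcases hiv with h | h
        · exact Or.inl (key2 b x kb.1 kb.2 h1 h3 i hi h)
        · exact Or.inr (key2 c x kc.1 kc.2 h1 h3 i hi h)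
      · rintro (rfl | rfl)
        · exact kb
        · exact kc
    rw [this, Finset.card_pair hbc]
  · rw [hP.splitsOf_eq]
    congr 1
    have hcl : ∀ v, v ≠ leaf r → clus p leaf v = cl v := by
      intro v hv
      ext i
      rw [mem_clus, hanc]
      by_cases hi : i = r
      · subst hi
        rw [hroot]
        constructor
        · intro h; exact h (Finset.mem_univ _)
        · intro h; exact absurd h (huniv v hv)
      · rw [hleaf i hi, Finset.singleton_subset_iff]
    ext A
    simp only [Finset.mem_image, Finset.mem_filter, Finset.mem_univ, true_and]
    constructor
    · rintro ⟨v, hv, rfl⟩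
      rw [hcl v hv]; exact hclH v hv
    · intro hA
      obtain ⟨v, rfl⟩ := (hmem A).2 (Or.inr hA)
      have hv : v ≠ leaf r := by
        rintro rfl
        exact hr _ hA (by rw [hroot]; exact Finset.mem_univ _)
      exact ⟨v, hv, hcl v hv⟩

theorem realize {n : ℕ} (hn : 2 ≤ n) {r : Fin n} {H : Finset (Finset (Fin n))}
    (hH : H ∈ Hier (Finset.univ.erase r)) :
    ∃ G : SimpleGraph (Fin n ⊕ Fin (n - 2)), IsBinaryPhylo n G Sum.inl ∧
      splitsOf n G Sum.inl = H.image (fun A => s(A, Aᶜ)) := by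
  have hr := Hier.notMem hH (Finset.notMem_erase r _)
  obtain ⟨g1, g2, g3⟩ := mem_Hier.1 hH
  let L : Fin n → Finset (Fin n) := fun i => if i = r then Finset.univ else {i}
  have hLr : L r = Finset.univ := by simp [L]
  have hLi : ∀ i, i ≠ r → L i = {i} := by intro i hi; simp [L, hi]
  have hL : Function.Injective L := by
    have key : ∀ i, i ≠ r → L r ≠ L i := by
      intro i hi h
      rw [hLr, hLi i hi] at h
      have := congrArg Finset.card h
      simp at this
      omega
    intro i j hij
    by_cases hi : i = r <;> by_cases hj : j = r
    · rw [hi, hj]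
    · rw [hi] at hij; exact absurd hij (key j hj)
    · rw [hj] at hij; exact absurd hij.symm (key i hi)
    · rw [hLi i hi, hLi j hj] at hij; simpa using hij
  have hu : (Finset.univ : Finset (Fin n)) ∉ H := fun h => hr _ h (Finset.mem_univ _)
  have hsub : Finset.univ.image L ⊆ insert Finset.univ H := by
    intro A hA
    rw [Finset.mem_image] at hA
    obtain ⟨i, -, rfl⟩ := hA
    rw [Finset.mem_insert]
    by_cases hi : i = r
    · left; rw [hi, hLr]
    · right; rw [hLi i hi]
      exact Hier.single hH (by simpa using hi)
  have hcard : (insert Finset.univ H \ Finset.univ.image L).card = n - 2 := by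
    rw [Finset.card_sdiff_of_subset hsub, Finset.card_insert_of_notMem hu,
      Finset.card_image_of_injective _ hL]
    rw [Finset.card_erase_of_mem (Finset.mem_univ _)] at g3
    simp at g3 ⊢
    omega
  let e := (Finset.equivFinOfCardEq hcard).symm
  refine realize_aux hn hH Sum.inl (Sum.elim L (fun k => (e k).1)) ?_ ?_ ?_ ?_
  · have hdis : ∀ i k, L i ≠ (e k).1 := by
      intro i k h
      have := (e k).2
      rw [Finset.mem_sdiff, ← h] at this
      exact this.2 (Finset.mem_image_of_mem _ (Finset.mem_univ _))
    exact hL.sumElim (Subtype.val_injective.comp e.injective) hdis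
  · intro A
    rw [← Finset.mem_insert]
    constructor
    · rintro ⟨i | k, rfl⟩
      · exact hsub (Finset.mem_image_of_mem _ (Finset.mem_univ _))
      · exact (Finset.mem_sdiff.1 (e k).2).1
    · intro hA
      by_cases h : A ∈ Finset.univ.image L
      · rw [Finset.mem_image] at h
        obtain ⟨i, -, rfl⟩ := h
        exact ⟨Sum.inl i, rfl⟩
      · refine ⟨Sum.inr (e.symm ⟨A, Finset.mem_sdiff.2 ⟨hA, h⟩⟩), ?_⟩
        simp
  · exact hLr
  · exact hLi

def toSplits {n : ℕ} (H : Finset (Finset (Fin n))) : Finset (Sym2 (Finset (Fin n))) :=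
  H.image (fun A => s(A, Aᶜ))

theorem split_inj {n : ℕ} {r : Fin n} {A B : Finset (Fin n)} (hA : r ∉ A) (hB : r ∉ B)
    (h : s(A, Aᶜ) = s(B, Bᶜ)) : A = B := by
  rw [Sym2.eq_iff] at h
  rcases h with h | h
  · exact h.1
  · exfalso
    rw [h.1] at hA
    simp at hA
    exact hB hA

theorem mem_toSplits {n : ℕ} {r : Fin n} {A : Finset (Fin n)} {H : Finset (Finset (Fin n))}
    (hA : r ∉ A) (hH : ∀ B ∈ H, r ∉ B) : s(A, Aᶜ) ∈ toSplits H ↔ A ∈ H := by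
  unfold toSplits
  rw [Finset.mem_image]
  constructor
  · rintro ⟨B, hB, h⟩
    rwa [← split_inj (hH B hB) hA h]
  · intro h
    exact ⟨A, h, rfl⟩

theorem allBPTSplits_eq {n : ℕ} (hn : 2 ≤ n) (r : Fin n) :
    allBPTSplits n = (Hier (Finset.univ.erase r)).image toSplits := by
  ext S
  unfold allBPTSplits
  simp only [Finset.mem_filter, Finset.mem_univ, true_and, Finset.mem_image]
  constructor
  · rintro ⟨G, hB, rfl⟩
    obtain ⟨p, d, hP⟩ := exists_isPar hB.1 (Sum.inl r)
    refine ⟨treeH p Sum.inl r, treeH_mem hB hP, ?_⟩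
    rw [hP.splitsOf_eq]
    rfl
  · rintro ⟨H, hH, rfl⟩
    obtain ⟨G, h1, h2⟩ := realize hn hH
    exact ⟨G, h1, h2⟩

theorem qCoeff_eq {n : ℕ} (hn : 2 ≤ n) {V : Type} [Fintype V] {G : SimpleGraph V}
    {leaf : Fin n → V} {r : Fin n} {T : Finset (Finset (Fin n))}
    (hT : T ∈ Hier (Finset.univ.erase r)) (hs : splitsOf n G leaf = toSplits T) (s : ℕ) :
    qCoeff n G leaf s = ((Hier (Finset.univ.erase r)).filter (fun H =>
      ((H ∩ T).filter (fun A => A.card ≠ 1 ∧ A.card + 1 ≠ n)).card = s)).card := by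
  have hTr := Hier.notMem hT (Finset.notMem_erase r _)
  unfold qCoeff
  rw [allBPTSplits_eq hn r, Finset.filter_image, Finset.card_image_of_injOn, hs]
  · congr 1
    apply Finset.filter_congr
    intro H hH
    have hHr := Hier.notMem hH (Finset.notMem_erase r _)
    have : ((toSplits H ∩ toSplits T).filter (fun σ => ¬ IsTrivialSplit σ)) =
        ((H ∩ T).filter (fun A => A.card ≠ 1 ∧ A.card + 1 ≠ n)).image (fun A => s(A, Aᶜ)) := by
      have htriv : ∀ A : Finset (Fin n), IsTrivialSplit s(A, Aᶜ) ↔ ¬ (A.card ≠ 1 ∧ A.card + 1 ≠ n) := by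
        intro A
        unfold IsTrivialSplit
        have h1 : A.card ≤ n := by simpa using Finset.card_le_univ A
        have h2 : Aᶜ.card = n - A.card := by rw [Finset.card_compl, Fintype.card_fin]
        constructor
        · rintro ⟨B, hB, hB1⟩
          rw [Sym2.mem_iff] at hB
          rcases hB with rfl | rfl <;> omega
        · intro h
          by_cases hA : A.card = 1
          · exact ⟨A, by simp, hA⟩
          · exact ⟨Aᶜ, by simp, by omega⟩
      ext σ
      simp only [Finset.mem_filter, Finset.mem_inter, Finset.mem_image]
      constructor
      · rintro ⟨⟨h1, h2⟩, h3⟩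
        unfold toSplits at h1
        rw [Finset.mem_image] at h1
        obtain ⟨A, hA, rfl⟩ := h1
        rw [mem_toSplits (hHr A hA) hTr] at h2
        rw [htriv, not_not] at h3
        exact ⟨A, ⟨⟨hA, h2⟩, h3⟩, rfl⟩
      · rintro ⟨A, ⟨⟨h1, h2⟩, h3⟩, rfl⟩
        rw [mem_toSplits (hHr A h1) hTr, mem_toSplits (hHr A h1) hHr, htriv, not_not]
        exact ⟨⟨h1, h2⟩, h3⟩
    rw [← Finset.card_image_of_injOn (s := (H ∩ T).filter _) (f := fun A => s(A, Aᶜ)), ← this]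
    intro A hA B hB h
    have hA := hHr A (Finset.mem_inter.1 (Finset.mem_filter.1 hA).1).1
    have hB := hHr B (Finset.mem_inter.1 (Finset.mem_filter.1 hB).1).1
    exact split_inj hA hB h
  · intro H hH H' hH' h
    have hH : H ∈ Hier (Finset.univ.erase r) := (Finset.mem_filter.1 hH).1
    have hH' : H' ∈ Hier (Finset.univ.erase r) := (Finset.mem_filter.1 hH').1
    have hHr := Hier.notMem hH (Finset.notMem_erase r _)
    have hHr' := Hier.notMem hH' (Finset.notMem_erase r _)
    ext A
    constructor
    · intro hA
      rwa [← mem_toSplits (hHr A hA) hHr', ← h, mem_toSplits (hHr A hA) hHr]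
    · intro hA
      rwa [← mem_toSplits (hHr' A hA) hHr, h, mem_toSplits (hHr' A hA) hHr']

end HierToGraph

section
variable {α : Type} [DecidableEq α]

theorem hh_three : hh 3 = 3 := by
  rw [show (3:ℕ) = 2 + 1 from rfl, hh_succ 2 (by norm_num), hh_two]

theorem hh_mul_le {k l : ℕ} (hk : 3 ≤ k) (hl : 3 ≤ l) : hh k * hh l ≤ 3 * hh (k + l - 3) := by
  induction k, hk using Nat.le_induction with
  | base => rw [hh_three, show 3 + l - 3 = l by omega]
  | succ k hk ih =>
    rw [hh_succ k (by omega), show k + 1 + l - 3 = (k + l - 3) + 1 by omega,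
      hh_succ (k + l - 3) (by omega)]
    calc (2 * k - 1) * hh k * hh l = (2 * k - 1) * (hh k * hh l) := by ring
      _ ≤ (2 * (k + l - 3) - 1) * (3 * hh (k + l - 3)) := Nat.mul_le_mul (by omega) ih
      _ = _ := by ring

theorem bad_card {X : Finset α} {T : Finset (Finset α)} (hT : T ∈ Hier X) (h3 : 3 ≤ X.card) :
    ((Hier X).filter (fun H => ∃ A ∈ H ∩ T, 3 ≤ A.card ∧ A.card < X.card)).card * X.card
      ≤ 16 * hh X.card := by
  obtain ⟨hsub, ⟨hne, hlam⟩, hcard⟩ := mem_Hier.1 hT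
  set m := X.card with hm
  clear_value m
  by_cases h4 : m = 3
  · have : (Hier X).filter (fun H => ∃ A ∈ H ∩ T, 3 ≤ A.card ∧ A.card < m) = ∅ := by
      apply Finset.filter_eq_empty_iff.2
      rintro H - ⟨A, -, h1, h2⟩
      omega
    rw [this]; simp
  have h4 : 4 ≤ m := by omega
  let T1 := T.filter (fun A => A.card = m - 1)
  let T2 := T.filter (fun A => 3 ≤ A.card ∧ A.card + 2 ≤ m)
  have hT1 : T1.card ≤ 1 := by
    apply Finset.card_le_one.2
    intro A hA B hB
    simp only [T1, Finset.mem_filter] at hA hB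
    have := hlam A hA.1 B hB.1
    rcases this.symm with h | h | h
    · exact (Finset.eq_of_subset_of_card_le h (by omega)).symm
    · exact Finset.eq_of_subset_of_card_le h (by omega)
    · have := Finset.card_union_of_disjoint h
      have h2 := Finset.card_le_card (Finset.union_subset (hsub B hB.1) (hsub A hA.1))
      omega
  have hT2 : T2.card ≤ 2 * m - 1 := by
    have := Finset.card_filter_le T (fun A => 3 ≤ A.card ∧ A.card + 2 ≤ m)
    simp only [T2]
    omega
  have hss : (Hier X).filter (fun H => ∃ A ∈ H ∩ T, 3 ≤ A.card ∧ A.card < m) ⊆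
      (T1.biUnion fun A => (Hier X).filter (fun H => A ∈ H)) ∪
      (T2.biUnion fun A => (Hier X).filter (fun H => A ∈ H)) := by
    intro H hH
    simp only [Finset.mem_filter, Finset.mem_inter] at hH
    obtain ⟨hH, A, ⟨hAH, hAT⟩, h1, h2⟩ := hH
    simp only [Finset.mem_union, Finset.mem_biUnion, Finset.mem_filter, T1, T2]
    by_cases h : A.card = m - 1
    · exact Or.inl ⟨A, ⟨hAT, h⟩, hH, hAH⟩
    · exact Or.inr ⟨A, ⟨hAT, h1, by omega⟩, hH, hAH⟩
  have hb1 : (T1.biUnion fun A => (Hier X).filter (fun H => A ∈ H)).card ≤ 1 * hh (m - 1) := by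
    refine (Finset.card_biUnion_le_card_mul _ _ (hh (m-1)) ?_).trans (Nat.mul_le_mul_right _ hT1)
    intro A hA
    simp only [T1, Finset.mem_filter] at hA
    have := card_Hier_mem_le (hne A hA.1) (hsub A hA.1)
    rw [hA.2, ← hm, show m - (m - 1) + 1 = 2 by omega, hh_two, mul_one] at this
    exact this
  have hb2 : (T2.biUnion fun A => (Hier X).filter (fun H => A ∈ H)).card
      ≤ (2 * m - 1) * (3 * hh (m - 2)) := by
    refine (Finset.card_biUnion_le_card_mul _ _ (3 * hh (m-2)) ?_).trans (Nat.mul_le_mul_right _ hT2)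
    intro A hA
    simp only [T2, Finset.mem_filter] at hA
    have := card_Hier_mem_le (hne A hA.1) (hsub A hA.1)
    have h2 := hh_mul_le (k := A.card) (l := m - A.card + 1) (by omega) (by omega)
    rw [show A.card + (m - A.card + 1) - 3 = m - 2 by omega] at h2
    rw [← hm] at this
    exact this.trans h2
  have htot := (Finset.card_le_card hss).trans ((Finset.card_union_le _ _).trans (add_le_add hb1 hb2))
  obtain ⟨k, rfl⟩ : ∃ k, m = k + 4 := ⟨m - 4, by omega⟩
  have e1 := hh_succ (k + 3) (by omega)
  have e2 := hh_succ (k + 2) (by omega)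
  simp only [show k + 4 - 1 = k + 3 by omega, show k + 4 - 2 = k + 2 by omega,
    show 2 * (k + 4) - 1 = 2 * k + 7 by omega] at htot
  rw [show 2 * (k + 2) - 1 = 2 * k + 3 by omega] at e2
  rw [show 2 * (k + 3) - 1 = 2 * k + 5 by omega] at e1
  refine (Nat.mul_le_mul_right _ htot).trans ?_
  rw [show k + 4 = k + 3 + 1 from rfl, e1, show k + 3 = k + 2 + 1 from rfl, e2]
  have : (2 * k + 3 + (2 * k + 7) * 3) * (k + 4) ≤ 16 * ((2 * k + 5) * (2 * k + 3)) := by nlinarith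
  calc _ = ((2 * k + 3 + (2 * k + 7) * 3) * (k + 4)) * hh (k + 2) := by ring
    _ ≤ _ := Nat.mul_le_mul_right _ this
    _ = _ := by ring
end

theorem hs_congr {f g : ℕ → ℝ} {a b : ℝ} (h : HasSum f a) (h1 : ∀ k, g k = f k) (h2 : b = a) :
    HasSum g b := by
  rw [funext h1, h2]; exact h

theorem inv_hasSum (y s : ℕ) :
    HasSum (fun k : ℕ => ((-1:ℝ)^(k+s) * (k.choose s : ℝ)) * (y.choose k : ℝ))
      (if y = s then 1 else 0) := by
  rw [← Function.Injective.hasSum_iff (add_left_injective s)]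
  swap
  · intro k hk
    have : k < s := by
      by_contra h
      exact hk ⟨k - s, by simp; omega⟩
    simp [Nat.choose_eq_zero_of_lt this]
  have h1 : ∀ j, (((fun k : ℕ => ((-1:ℝ)^(k+s) * (k.choose s : ℝ)) * (y.choose k : ℝ)) ∘
      fun x => x + s) j) = (y.choose s : ℝ) * ((-1)^j * ((y - s).choose j : ℝ)) := by
    intro j
    simp only [Function.comp]
    have e1 : (-1:ℝ)^(j + s + s) = (-1)^j := by
      rw [add_assoc, pow_add, ← two_mul, pow_mul]; simp
    rw [e1]
    by_cases hy : j + s ≤ y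
    · have := Nat.choose_mul (n := y) (Nat.le_add_left s j)
      rw [Nat.add_sub_cancel] at this
      have : ((y.choose (j+s) : ℝ)) * ((j+s).choose s : ℝ) = (y.choose s : ℝ) * ((y-s).choose j : ℝ) := by
        exact_mod_cast this
      linear_combination (-1)^j * this
    · rw [Nat.choose_eq_zero_of_lt (by omega : y < j + s)]
      by_cases hs : s ≤ y
      · rw [Nat.choose_eq_zero_of_lt (by omega : y - s < j)]; simp
      · rw [Nat.choose_eq_zero_of_lt (by omega : y < s)]; simp
  have h2 := hasSum_sum_of_ne_finset_zero (L := .unconditional ℕ) (f := fun j => (-1:ℝ)^j * ((y - s).choose j : ℝ))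
    (s := Finset.range (y - s + 1)) (by
      intro b hb
      rw [Nat.choose_eq_zero_of_lt (by simpa using hb)]; simp)
  have h3 : ∑ j ∈ Finset.range (y - s + 1), (-1:ℝ)^j * ((y - s).choose j : ℝ)
      = if y - s = 0 then 1 else 0 := by
    have := Int.alternating_sum_range_choose (n := y - s)
    exact_mod_cast congrArg (Int.cast : ℤ → ℝ) this
  rw [h3] at h2
  refine hs_congr (h2.mul_left (y.choose s : ℝ)) h1 ?_
  by_cases h : y = s
  · simp [h]
  · by_cases h' : y < s
    · simp [h, Nat.choose_eq_zero_of_lt h']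
    · rw [if_neg h, if_neg (by omega)]; simp

theorem poi_hasSum (l : ℝ) (s : ℕ) :
    HasSum (fun k : ℕ => ((-1:ℝ)^(k+s) * (k.choose s : ℝ)) * (l^k / (k.factorial : ℝ)))
      (Real.exp (-l) * l^s / (s.factorial : ℝ)) := by
  rw [← Function.Injective.hasSum_iff (add_left_injective s)]
  swap
  · intro k hk
    have : k < s := by
      by_contra h
      exact hk ⟨k - s, by simp; omega⟩
    simp [Nat.choose_eq_zero_of_lt this]
  have h := (NormedSpace.expSeries_div_hasSum_exp (-l)).mul_right (l^s / (s.factorial : ℝ))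
  rw [← Real.exp_eq_exp_ℝ] at h
  refine hs_congr h (fun j => ?_) ?_
  · 
    simp only [Function.comp]
    have e1 : (-1:ℝ)^(j + s + s) = (-1)^j := by
      rw [add_assoc, pow_add, ← two_mul, pow_mul]; simp
    rw [e1, neg_pow l j]
    have := Nat.add_choose_mul_factorial_mul_factorial j s
    have h3 : (((j+s).choose s : ℕ) : ℝ) * (j.factorial : ℝ) * (s.factorial : ℝ) = ((j+s).factorial : ℝ) := by
      exact_mod_cast this
    have a1 : (j.factorial : ℝ) ≠ 0 := by positivity
    have a2 : (s.factorial : ℝ) ≠ 0 := by positivity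
    have a3 : ((j+s).factorial : ℝ) ≠ 0 := by positivity
    field_simp
    rw [← h3]; ring
  · ring

theorem poisson_moments {ι : Type*} (Ω : Finset ι) (Y : ι → ℕ) (l δ : ℝ)
    (h : ∀ k : ℕ, |(k.factorial : ℝ) * ((∑ H ∈ Ω, ((Y H).choose k : ℝ)) / (Ω.card : ℝ)) - l^k| ≤ δ * 4^k)
    (S : ℕ) :
    ∑ s ∈ Finset.range S, |((Ω.filter (fun H => Y H = s)).card : ℝ) / (Ω.card : ℝ) -
      Real.exp (-l) * l^s / (s.factorial : ℝ)| ≤ δ * Real.exp 8 := by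
  set D : ℕ → ℝ := fun k => (∑ H ∈ Ω, ((Y H).choose k : ℝ)) / (Ω.card : ℝ) - l^k / (k.factorial : ℝ) with hD
  have hDb : ∀ k, |D k| ≤ δ * 4^k / (k.factorial : ℝ) := by
    intro k
    have a1 : (0:ℝ) < (k.factorial : ℝ) := by positivity
    rw [le_div_iff₀ a1]
    refine le_trans (le_of_eq ?_) (h k)
    rw [← abs_of_pos a1, ← abs_mul, abs_of_pos a1, hD]
    congr 1
    field_simp
  have hs : ∀ s, HasSum (fun k : ℕ => ((-1:ℝ)^(k+s) * (k.choose s : ℝ)) * D k)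
      (((Ω.filter (fun H => Y H = s)).card : ℝ) / (Ω.card : ℝ) -
      Real.exp (-l) * l^s / (s.factorial : ℝ)) := by
    intro s
    have h1 := (hasSum_sum (s := Ω) (fun H _ => inv_hasSum (Y H) s)).div_const (Ω.card : ℝ)
    refine hs_congr (h1.sub (poi_hasSum l s)) (fun k => ?_) ?_
    · simp only [hD]
      rw [← Finset.mul_sum]; ring
    · congr 2
      rw [Finset.card_filter]; push_cast; rfl
  have hexp : HasSum (fun k : ℕ => δ * (8^k / (k.factorial : ℝ))) (δ * Real.exp 8) := by
    have h := (NormedSpace.expSeries_div_hasSum_exp (8:ℝ)).mul_left δ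
    rwa [← Real.exp_eq_exp_ℝ] at h
  have h8 : ∀ k : ℕ, 2^k * |D k| ≤ δ * (8^k / (k.factorial : ℝ)) := by
    intro k
    calc 2^k * |D k| ≤ 2^k * (δ * 4^k / (k.factorial : ℝ)) := by
          gcongr; exact hDb k
      _ = _ := by
        rw [show (8:ℝ) = 2 * 4 by norm_num, mul_pow]; ring
  have hch : ∀ k s : ℕ, ((k.choose s : ℕ) : ℝ) ≤ 2^k := by
    intro k s
    exact_mod_cast Nat.choose_le_two_pow k s
  have hsum : ∀ s, Summable (fun k : ℕ => (k.choose s : ℝ) * |D k|) := by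
    intro s
    refine Summable.of_nonneg_of_le (fun k => by positivity) (fun k => ?_) hexp.summable
    refine le_trans ?_ (h8 k)
    gcongr
    exact hch k s
  have hle : ∀ s, |((Ω.filter (fun H => Y H = s)).card : ℝ) / (Ω.card : ℝ) -
      Real.exp (-l) * l^s / (s.factorial : ℝ)| ≤ ∑' k, (k.choose s : ℝ) * |D k| := by
    intro s
    rw [← (hs s).tsum_eq]
    have e : ∀ k : ℕ, ‖((-1:ℝ)^(k+s) * (k.choose s : ℝ)) * D k‖ = (k.choose s : ℝ) * |D k| := by
      intro k
      rw [norm_mul, norm_mul, norm_pow]; simp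
    rw [← Real.norm_eq_abs]
    refine (norm_tsum_le_tsum_norm ?_).trans (le_of_eq ?_)
    · simp_rw [e]; exact hsum s
    · simp_rw [e]
  calc _ ≤ ∑ s ∈ Finset.range S, ∑' k, (k.choose s : ℝ) * |D k| := Finset.sum_le_sum fun s _ => hle s
    _ = ∑' k, ∑ s ∈ Finset.range S, (k.choose s : ℝ) * |D k| :=
        (Summable.tsum_finsetSum fun s _ => hsum s).symm
    _ ≤ ∑' k : ℕ, δ * (8^k / (k.factorial : ℝ)) := by
        refine Summable.tsum_le_tsum (fun k => ?_) (summable_sum fun s _ => hsum s) hexp.summable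
        rw [← Finset.sum_mul]
        refine le_trans ?_ (h8 k)
        gcongr
        have : ∑ s ∈ Finset.range S, k.choose s ≤ 2^k := by
          rw [← Nat.sum_range_choose k]
          calc _ ≤ ∑ s ∈ Finset.range (max S (k+1)), k.choose s :=
                Finset.sum_le_sum_of_subset (Finset.range_mono (le_max_left _ _))
            _ = _ := by
                symm
                apply Finset.sum_subset (Finset.range_mono (le_max_right _ _))
                intro x _ hx
                exact Nat.choose_eq_zero_of_lt (by simpa using hx)
        exact_mod_cast this
    _ = _ := hexp.tsum_eq

theorem tv_le {ι : Type*} (Ω : Finset ι) (X Y : ι → ℕ) (S : ℕ) :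
    ∑ s ∈ Finset.range S, |((Ω.filter (fun H => X H = s)).card : ℝ) -
      ((Ω.filter (fun H => Y H = s)).card : ℝ)| ≤ 2 * ((Ω.filter (fun H => X H ≠ Y H)).card : ℝ) := by
  have h1 : ∀ s, |((Ω.filter (fun H => X H = s)).card : ℝ) -
      ((Ω.filter (fun H => Y H = s)).card : ℝ)| ≤
      ∑ H ∈ Ω.filter (fun H => X H ≠ Y H), ((if X H = s then (1:ℝ) else 0) + if Y H = s then 1 else 0) := by
    intro s
    rw [Finset.card_filter, Finset.card_filter]
    push_cast
    rw [← Finset.sum_sub_distrib, Finset.sum_filter]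
    refine (Finset.abs_sum_le_sum_abs _ _).trans (Finset.sum_le_sum fun H _ => ?_)
    split_ifs <;> simp_all
  refine (Finset.sum_le_sum fun s _ => h1 s).trans ?_
  rw [Finset.sum_comm, mul_comm, ← nsmul_eq_mul]
  apply Finset.sum_le_card_nsmul
  intro H _
  rw [Finset.sum_add_distrib, Finset.sum_ite_eq, Finset.sum_ite_eq]
  split_ifs <;> norm_num

section
variable {α : Type} [DecidableEq α]

theorem moment_sum {X : Finset α} (hX : X.Nonempty) (P : Finset (Finset α))
    (hP : ∀ A ∈ P, A ⊆ X ∧ A.card = 2) (hd : ∀ A ∈ P, ∀ B ∈ P, A ≠ B → Disjoint A B) (k : ℕ) :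
    ∑ H ∈ Hier X, ((P ∩ H).card).choose k = (P.card).choose k * hh (X.card - k) := by
  have h1 : ∀ H ∈ Hier X, ((P ∩ H).card).choose k =
      ∑ K ∈ P.powersetCard k, if K ⊆ H then 1 else 0 := by
    intro H _
    rw [← Finset.card_powersetCard, ← Finset.card_filter]
    congr 1
    ext K
    simp only [Finset.mem_powersetCard, Finset.mem_filter, Finset.subset_inter_iff]
    tauto
  rw [Finset.sum_congr rfl h1, Finset.sum_comm, ← Finset.card_powersetCard k P, ← smul_eq_mul]
  apply Finset.sum_eq_card_nsmul
  intro K hK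
  obtain ⟨hKP, hKc⟩ := Finset.mem_powersetCard.1 hK
  rw [← Finset.card_filter, ← hKc]
  exact card_Hier_pairs K hX (fun Q hQ => hP Q (hKP hQ)) (fun A hA B hB => hd A (hKP hA) B (hKP hB))
end

theorem moment_bound {m c' c : ℕ} (hm : 3 ≤ m) (hc : 2 * c' ≤ m) (h1 : c' ≤ c) (h2 : c ≤ c' + 3) :
    ∀ k : ℕ, 0 ≤ (k.factorial : ℝ) * ((c'.choose k * hh (m - k) : ℕ) / (hh m : ℝ)) ∧
      (k.factorial : ℝ) * ((c'.choose k * hh (m - k) : ℕ) / (hh m : ℝ)) ≤ 1 ∧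
      |(k.factorial : ℝ) * ((c'.choose k * hh (m - k) : ℕ) / (hh m : ℝ)) -
        ((c : ℝ) / (2 * ((m + 1 : ℕ) : ℝ)))^k| ≤ 11 / ((m + 1 : ℕ) : ℝ) * 4^k := by
  have hhm : (0:ℝ) < (hh m : ℝ) := by exact_mod_cast hh_pos m
  set l : ℝ := (c : ℝ) / (2 * ((m + 1 : ℕ) : ℝ)) with hl
  have hn0 : (0:ℝ) < ((m + 1 : ℕ) : ℝ) := by positivity
  have hl0 : 0 ≤ l := by positivity
  have hl1 : l ≤ 1 := by
    rw [hl, div_le_one (by positivity)]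
    have : c ≤ 2 * (m + 1) := by omega
    exact_mod_cast this
  intro k
  induction k with
  | zero =>
    have : (hh m : ℝ) / (hh m : ℝ) = 1 := div_self hhm.ne'
    simp [this]
    positivity
  | succ k ih =>
    obtain ⟨i0, i1, i2⟩ := ih
    set A := (k.factorial : ℝ) * ((c'.choose k * hh (m - k) : ℕ) / (hh m : ℝ)) with hA
    set B := ((k+1).factorial : ℝ) * ((c'.choose (k+1) * hh (m - (k+1)) : ℕ) / (hh m : ℝ)) with hB
    obtain ⟨a, ha0, ha1, haB, hal⟩ : ∃ a : ℝ, 0 ≤ a ∧ a ≤ 1 ∧ B = a * A ∧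
        |a - l| ≤ (11 + 4 * (k:ℝ)) / ((m + 1 : ℕ) : ℝ) := by
      by_cases hk : k < c'
      · obtain ⟨u, hu⟩ : ∃ u, m = u + k + 2 := ⟨m - k - 2, by omega⟩
        obtain ⟨v, hv⟩ : ∃ v, c' = v + k + 1 := ⟨c' - k - 1, by omega⟩
        have hd : (0:ℝ) < 2 * (u:ℝ) + 1 := by positivity
        refine ⟨((v:ℝ) + 1) / (2 * (u:ℝ) + 1), by positivity, ?_, ?_, ?_⟩
        · rw [div_le_one hd]
          have : v + 1 ≤ 2 * u + 1 := by omega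
          exact_mod_cast this
        · have e1 := hh_succ (u + 1) (by omega)
          rw [show 2 * (u + 1) - 1 = 2 * u + 1 by omega] at e1
          have e2 := Nat.choose_succ_right_eq c' k
          rw [show c' - k = v + 1 by omega] at e2
          rw [hB, hA, show m - (k + 1) = u + 1 by omega, show m - k = u + 1 + 1 by omega, e1,
            Nat.factorial_succ]
          have e3 : ((c'.choose (k+1) : ℕ) : ℝ) * ((k:ℝ) + 1) = (c'.choose k : ℝ) * ((v:ℝ) + 1) := by
            exact_mod_cast e2
          push_cast
          field_simp
          linear_combination (hh (u+1) : ℝ) * e3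
        · have hle : ((v:ℝ) + 1) / (2 * (u:ℝ) + 1) - l =
              (((v:ℝ) + 1) * (2 * ((m + 1 : ℕ) : ℝ)) - (2 * (u:ℝ) + 1) * (c:ℝ)) /
                ((2 * (u:ℝ) + 1) * (2 * ((m + 1 : ℕ) : ℝ))) := by
            rw [hl, div_sub_div _ _ hd.ne' (by positivity)]
          have hvm : 2 * (v:ℝ) + 2 * k + 2 ≤ u + k + 2 := by
            have : 2 * v + 2 * k + 2 ≤ u + k + 2 := by omega
            exact_mod_cast this
          have hc1 : (v:ℝ) + k + 1 ≤ c := by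
            have : v + k + 1 ≤ c := by omega
            exact_mod_cast this
          have hc2 : (c:ℝ) ≤ v + k + 4 := by
            have : c ≤ v + k + 4 := by omega
            exact_mod_cast this
          have hu0 : (0:ℝ) ≤ u := by positivity
          have hv0 : (0:ℝ) ≤ v := by positivity
          have hk0 : (0:ℝ) ≤ k := by positivity
          rw [hle, abs_div, abs_of_pos (by positivity : (0:ℝ) < (2 * (u:ℝ) + 1) * (2 * ((m + 1 : ℕ) : ℝ))),
            div_le_div_iff₀ (by positivity) hn0]
          have hmm : ((m + 1 : ℕ) : ℝ) = u + k + 3 := by rw [hu]; push_cast; ring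
          have key : |((v:ℝ) + 1) * (2 * ((m + 1 : ℕ) : ℝ)) - (2 * (u:ℝ) + 1) * (c:ℝ)| ≤
              (11 + 4 * (k:ℝ)) * ((2 * (u:ℝ) + 1) * 2) := by
            rw [hmm, abs_le]
            constructor <;> nlinarith
          calc _ ≤ (11 + 4 * (k:ℝ)) * ((2 * (u:ℝ) + 1) * 2) * ((m + 1 : ℕ) : ℝ) := by gcongr
            _ = _ := by ring
      · refine ⟨0, le_rfl, zero_le_one, ?_, ?_⟩
        · rw [hB, Nat.choose_eq_zero_of_lt (by omega)]; simp
        · rw [zero_sub, abs_neg, abs_of_nonneg hl0, hl, div_le_div_iff₀ (by positivity) hn0]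
          have : (c:ℝ) ≤ k + 3 := by
            have : c ≤ k + 3 := by omega
            exact_mod_cast this
          have hk0 : (0:ℝ) ≤ k := by positivity
          nlinarith
    clear_value A B
    have hk4 : (k:ℝ) + 1 ≤ 4^k := by
      have : k < 4^k := Nat.lt_pow_self (by norm_num)
      exact_mod_cast this
    refine ⟨by rw [haB]; positivity, by rw [haB]; exact mul_le_one₀ ha1 i0 i1, ?_⟩
    have e : B - l^(k+1) = (a - l) * A + l * (A - l^k) := by rw [haB]; ring
    rw [e]
    calc |(a - l) * A + l * (A - l^k)| ≤ |a - l| * A + l * |A - l^k| := by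
          refine (abs_add_le _ _).trans ?_
          rw [abs_mul, abs_mul, abs_of_nonneg i0, abs_of_nonneg hl0]
      _ ≤ (11 + 4 * (k:ℝ)) / ((m + 1 : ℕ) : ℝ) * 1 + 1 * (11 / ((m + 1 : ℕ) : ℝ) * 4^k) := by
          gcongr
      _ = (11 + 4 * (k:ℝ) + 11 * 4^k) / ((m + 1 : ℕ) : ℝ) := by ring
      _ ≤ (11 * 4^(k+1)) / ((m + 1 : ℕ) : ℝ) := by
          gcongr
          rw [pow_succ]; linarith
      _ = _ := by ring

/-- **Poisson approximation.** There is a constant `C > 0` such that for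
all `n ≥ 4` and all `T ∈ BPT(n)`, the distribution `s ↦ q_s(T)/b(n)` of the number of
nontrivial splits shared by `T` and a uniformly random tree in `BPT(n)` is within
variational distance `C/n` of the Poisson distribution with mean `λ_T = c_T/(2n)`,
where `c_T` is the number of cherries of `T`. -/
theorem poisson_approximation :
    ∃ C : ℝ, 0 < C ∧ ∀ n : ℕ, 4 ≤ n →
      ∀ (V : Type) (_ : Fintype V) (G : SimpleGraph V) (leaf : Fin n → V),
        IsBinaryPhylo n G leaf →
        ∑' s : ℕ,
            |(qCoeff n G leaf s : ℝ) / (numBPT n) -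
              Real.exp (-((numCherries n G leaf : ℝ) / (2 * n))) *
                ((numCherries n G leaf : ℝ) / (2 * n)) ^ s / (s.factorial : ℝ)| ≤
          C / n := by
  refine ⟨64 + 11 * Real.exp 8, by positivity, ?_⟩
  intro n hn V _ G leaf hB
  let r : Fin n := ⟨0, by omega⟩
  obtain ⟨p, d, hP⟩ := exists_isPar hB.1 (leaf r)
  have hT := treeH_mem hB hP
  have hc1 := cherries_ge hB hP
  have hc2 := cherries_le hB hP
  have hs : splitsOf n G leaf = toSplits (treeH p leaf r) := by
    rw [hP.splitsOf_eq]; rfl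
  have hq := qCoeff_eq (by omega : 2 ≤ n) hT hs
  clear_value r
  generalize treeH p leaf r = T at *
  generalize numCherries n G leaf = c at *
  set X : Finset (Fin n) := Finset.univ.erase r with hXdef
  have hXc : X.card = n - 1 := by rw [hXdef, Finset.card_erase_of_mem (Finset.mem_univ _)]; simp
  obtain ⟨m, rfl⟩ : ∃ m, n = m + 1 := ⟨n - 1, by omega⟩
  rw [Nat.add_sub_cancel] at hXc
  have hm3 : 3 ≤ m := by omega
  have hXne : X.Nonempty := Finset.card_pos.1 (by omega)
  clear_value X
  obtain ⟨hsub, ⟨hne, hlam⟩, hcard⟩ := mem_Hier.1 hT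
  set P := T.filter (fun A => A.card = 2) with hPdef
  have hPmem : ∀ A ∈ P, A ⊆ X ∧ A.card = 2 := by
    intro A hA
    rw [hPdef, Finset.mem_filter] at hA
    exact ⟨hsub A hA.1, hA.2⟩
  have hPd : ∀ A ∈ P, ∀ B ∈ P, A ≠ B → Disjoint A B := by
    intro A hA B hB hAB
    rw [hPdef, Finset.mem_filter] at hA hB
    rcases hlam A hA.1 B hB.1 with h | h | h
    · exact absurd (Finset.eq_of_subset_of_card_le h (by omega)) hAB
    · exact absurd (Finset.eq_of_subset_of_card_le h (by omega)).symm hAB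
    · exact h
  have hP2 : 2 * P.card ≤ m := by
    have h1 : (P.biUnion id).card = ∑ A ∈ P, A.card :=
      Finset.card_biUnion (fun A hA B hB h => hPd A hA B hB h)
    rw [Finset.sum_congr rfl (fun A hA => (hPmem A hA).2), Finset.sum_const, smul_eq_mul] at h1
    have h2 : (P.biUnion id).card ≤ X.card :=
      Finset.card_le_card (Finset.biUnion_subset.2 fun A hA => (hPmem A hA).1)
    omega
  have hN : (Hier X).card = numBPT (m + 1) := by
    rw [card_Hier hXne, hXc]; rfl
  have hN' : (Hier X).card = hh m := by rw [card_Hier hXne, hXc]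
  have hNpos : (0:ℝ) < (hh m : ℝ) := by exact_mod_cast hh_pos m
  have hn0 : (0:ℝ) < ((m + 1 : ℕ) : ℝ) := by positivity
  set l : ℝ := (c : ℝ) / (2 * ((m + 1 : ℕ) : ℝ)) with hl
  let Xs : Finset (Finset (Fin (m+1))) → ℕ := fun H =>
    ((H ∩ T).filter (fun A => A.card ≠ 1 ∧ A.card + 1 ≠ m + 1)).card
  let Ys : Finset (Finset (Fin (m+1))) → ℕ := fun H => (P ∩ H).card
  have hbad : (((Hier X).filter (fun H => Xs H ≠ Ys H)).card : ℝ) / (hh m : ℝ) ≤ 32 / ((m + 1 : ℕ) : ℝ) := by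
    have h1 := bad_card hT (by omega)
    have h2 : (Hier X).filter (fun H => Xs H ≠ Ys H) ⊆
        (Hier X).filter (fun H => ∃ A ∈ H ∩ T, 3 ≤ A.card ∧ A.card < X.card) := by
      intro H hH
      rw [Finset.mem_filter] at hH ⊢
      refine ⟨hH.1, ?_⟩
      by_contra hcon
      push Not at hcon
      apply hH.2
      simp only [Xs, Ys]
      congr 1
      ext A
      simp only [hPdef, Finset.mem_filter, Finset.mem_inter]
      constructor
      · rintro ⟨⟨hA, hA'⟩, h3, h4⟩
        have h5 := hcon A (Finset.mem_inter.2 ⟨hA, hA'⟩)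
        have h6 := Finset.card_pos.2 (hne A hA')
        have h7 := Finset.card_le_card (hsub A hA')
        refine ⟨⟨hA', ?_⟩, hA⟩
        by_contra h8
        have := h5 (by omega)
        omega
      · rintro ⟨⟨hA', h2⟩, hA⟩
        exact ⟨⟨hA, hA'⟩, by omega, by omega⟩
    have h3 := Finset.card_le_card h2
    rw [hXc] at h1
    have h4 : ((Hier X).filter (fun H => Xs H ≠ Ys H)).card * (m + 1) ≤ 32 * hh m := by
      have : ((Hier X).filter (fun H => Xs H ≠ Ys H)).card * m ≤ 16 * hh m :=
        le_trans (Nat.mul_le_mul_right m (by rw [hXc] at h3; exact h3)) h1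
      nlinarith
    rw [div_le_div_iff₀ hNpos hn0]
    exact_mod_cast h4
  have hmom : ∀ k : ℕ, |(k.factorial : ℝ) * ((∑ H ∈ Hier X, ((Ys H).choose k : ℝ)) / ((Hier X).card : ℝ)) - l^k|
      ≤ 11 / ((m + 1 : ℕ) : ℝ) * 4^k := by
    intro k
    have h1 := (moment_bound hm3 hP2 hc1 hc2 k).2.2
    have h2 := moment_sum hXne P hPmem hPd k
    rw [hXc] at h2
    rw [← h2] at h1
    rw [hN']
    push_cast at h1 ⊢
    rw [hl]
    push_cast
    exact h1
  refine Real.tsum_le_of_sum_range_le (fun s => abs_nonneg _) (fun S => ?_)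
  have hpm := poisson_moments (Hier X) Ys l _ hmom S
  have htv := tv_le (Hier X) Xs Ys S
  rw [← hN]
  calc _ ≤ ∑ s ∈ Finset.range S, (|(((Hier X).filter (fun H => Xs H = s)).card : ℝ) -
      (((Hier X).filter (fun H => Ys H = s)).card : ℝ)| / ((Hier X).card : ℝ) +
      |(((Hier X).filter (fun H => Ys H = s)).card : ℝ) / ((Hier X).card : ℝ) -
      Real.exp (-l) * l^s / (s.factorial : ℝ)|) := by
        apply Finset.sum_le_sum
        intro s _
        rw [hq s]
        have : (0:ℝ) ≤ ((Hier X).card : ℝ) := by positivity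
        conv_rhs => rw [← abs_of_nonneg this, ← abs_div, abs_of_nonneg this, sub_div]
        exact abs_sub_le _ _ _
    _ ≤ 2 * (32 / ((m + 1 : ℕ) : ℝ)) + 11 / ((m + 1 : ℕ) : ℝ) * Real.exp 8 := by
        rw [Finset.sum_add_distrib, ← Finset.sum_div]
        refine add_le_add ?_ hpm
        rw [hN']
        refine le_trans (div_le_div_of_nonneg_right htv hNpos.le) ?_
        rw [mul_div_assoc]
        linarith
    _ = _ := by ring
end

section
/- There exists a constant C > 0 such that for all integers n ≥ 4 and all integers c with 1 ≤ c ≤ n/2, setting λ = c/(2n): ∑_{s ≥ 0} | ∑_{r=s}^{c} (−1)^{r−s} · C(r,s) · C(c,r) · b(n−r)/b(n) − e^{−λ} λ^s / s! | ≤ C/n, where the inner sum is empty (equal to 0) when s > c, and C(·,·) denotes binomial coefficients. -/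
lemma numBPT_pos (n : ℕ) : 0 < numBPT n := by
  unfold numBPT
  apply Finset.prod_pos
  intro k hk
  rw [Finset.mem_Icc] at hk
  omega

lemma numBPT_succ (m : ℕ) (hm : 2 ≤ m) :
    (numBPT (m + 1) : ℝ) = numBPT m * (2 * (m : ℝ) - 3) := by
  unfold numBPT
  rw [Finset.prod_Icc_succ_top (by omega)]
  obtain ⟨k, rfl⟩ := Nat.exists_eq_add_of_le hm
  have : 2 * (2 + k + 1) - 5 = 2 * k + 1 := by omega
  rw [this]
  push_cast
  ring

noncomputable def facMom (n c r : ℕ) : ℝ :=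
  (c.descFactorial r : ℝ) * (numBPT (n - r) : ℝ) / (numBPT n : ℝ)

lemma facMom_succ (n c r : ℕ) (hn : 4 ≤ n) (hc : 2 * c ≤ n) :
    ∃ y : ℝ, facMom n c (r + 1) = facMom n c r * y ∧ |y| ≤ 1 ∧
      |y - (c : ℝ) / (2 * n)| ≤ 4 / n * (r + 2) := by
  have hn' : (4 : ℝ) ≤ n := by exact_mod_cast hn
  have hc' : 2 * (c : ℝ) ≤ n := by exact_mod_cast hc
  by_cases h : r < c
  · have h' : (r : ℝ) + 1 ≤ c := by exact_mod_cast h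
    have hr0 : (0 : ℝ) ≤ r := by positivity
    have hd : (n : ℝ) - 3 ≤ 2 * n - 2 * r - 5 := by linarith
    have hd0 : (0 : ℝ) < 2 * n - 2 * r - 5 := by linarith
    refine ⟨((c : ℝ) - r) / (2 * n - 2 * r - 5), ?_, ?_, ?_⟩
    · unfold facMom
      have hb := numBPT_succ (n - (r + 1)) (by omega)
      have e1 : n - (r + 1) + 1 = n - r := by omega
      rw [e1, Nat.cast_sub (by omega)] at hb
      rw [hb, Nat.descFactorial_succ, Nat.cast_mul, Nat.cast_sub h.le]
      have e2 : (2 * ((n : ℝ) - ((r + 1 : ℕ) : ℝ)) - 3) = 2 * n - 2 * r - 5 := by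
        push_cast; ring
      rw [e2]
      have := numBPT_pos n
      generalize (2 * (n : ℝ) - 2 * r - 5) = d at hd0
      field_simp
    · rw [abs_of_nonneg (div_nonneg (by linarith) hd0.le), div_le_one hd0]
      linarith
    · have e : ((c : ℝ) - r) / (2 * n - 2 * r - 5) - (c : ℝ) / (2 * n)
          = (2 * c * r + 5 * c - 2 * n * r) / (2 * n * (2 * n - 2 * r - 5)) := by
        have hne := hd0.ne'
        have hn0 : (n : ℝ) ≠ 0 := by positivity
        rw [div_sub_div _ _ hne (by positivity), div_eq_div_iff (by positivity) (by positivity)]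
        ring
      rw [e, abs_div, abs_of_pos (show (0 : ℝ) < 2 * n * (2 * n - 2 * r - 5) by positivity),
        div_le_iff₀ (by positivity)]
      have e3 : 4 / (n : ℝ) * (r + 2) * (2 * n * (2 * n - 2 * r - 5))
          = 8 * (r + 2) * (2 * n - 2 * r - 5) := by
        field_simp
        ring
      rw [e3]
      have h4 : (n : ℝ) / 4 ≤ 2 * n - 2 * r - 5 := by linarith
      have h5 : 8 * ((r : ℝ) + 2) * (n / 4) ≤ 8 * (r + 2) * (2 * n - 2 * r - 5) := by gcongr
      have h6 : (c : ℝ) * r ≤ n * r := by gcongr; linarith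
      have h7 : 0 ≤ (c : ℝ) * r := by positivity
      rw [abs_le]
      constructor <;> nlinarith
  · push Not at h
    have h' : (c : ℝ) ≤ r := by exact_mod_cast h
    refine ⟨0, ?_, by simp, ?_⟩
    · unfold facMom
      rw [Nat.descFactorial_eq_zero_iff_lt.2 (by omega : c < r + 1)]
      simp
    · rw [zero_sub, abs_neg, abs_of_nonneg (by positivity), div_le_iff₀ (by positivity)]
      have : 4 / (n : ℝ) * (r + 2) * (2 * n) = 8 * (r + 2) := by field_simp; ring
      rw [this]
      have : (0 : ℝ) ≤ c := by positivity
      linarith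

lemma facMom_bound (n c r : ℕ) (hn : 4 ≤ n) (hc : 2 * c ≤ n) :
    |facMom n c r - ((c : ℝ) / (2 * n)) ^ r| ≤ 12 / n * 2 ^ r := by
  have hn' : (4 : ℝ) ≤ n := by exact_mod_cast hn
  have hc' : 2 * (c : ℝ) ≤ n := by exact_mod_cast hc
  induction r with
  | zero =>
    have := numBPT_pos n
    have h1 : facMom n c 0 = 1 := by
      unfold facMom
      simp [this.ne']
    rw [h1]
    simp
    positivity
  | succ r ih =>
    obtain ⟨y, hy, hy1, hy2⟩ := facMom_succ n c r hn hc
    set l := (c : ℝ) / (2 * n) with hl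
    have hl0 : 0 ≤ l := by positivity
    have hl1 : l ≤ 1 := by rw [hl, div_le_one (by positivity)]; linarith
    have e : facMom n c (r + 1) - l ^ (r + 1)
        = (facMom n c r - l ^ r) * y + l ^ r * (y - l) := by rw [hy]; ring
    have hr2 : (r : ℝ) + 2 ≤ 3 * 2 ^ r := by
      have h1 : r < 2 ^ r := Nat.lt_two_pow_self
      have h2 : (r : ℝ) ≤ 2 ^ r := by exact_mod_cast h1.le
      have h3 : (1 : ℝ) ≤ 2 ^ r := one_le_pow₀ (by norm_num)
      linarith
    calc |facMom n c (r + 1) - l ^ (r + 1)|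
        ≤ |facMom n c r - l ^ r| * |y| + |l ^ r| * |y - l| := by
          rw [e, ← abs_mul, ← abs_mul]; exact abs_add_le _ _
      _ ≤ (12 / n * 2 ^ r) * 1 + 1 * (4 / n * (r + 2)) := by
          gcongr
          rw [abs_of_nonneg (by positivity)]
          exact pow_le_one₀ hl0 hl1
      _ ≤ (12 / n * 2 ^ r) * 1 + 1 * (4 / n * (3 * 2 ^ r)) := by gcongr
      _ = 12 / n * 2 ^ (r + 1) := by ring

lemma hasSum_exp_real (x : ℝ) : HasSum (fun k : ℕ => x ^ k / (k.factorial : ℝ)) (Real.exp x) := by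
  rw [Real.exp_eq_exp_ℝ]
  exact NormedSpace.expSeries_div_hasSum_exp x

lemma inner_hasSum (n c s : ℕ) :
    HasSum (fun k : ℕ => (-1 : ℝ) ^ k * facMom n c (s + k) / (s.factorial * k.factorial))
      (∑ r ∈ Finset.Icc s c,
              (-1 : ℝ) ^ (r - s) * (r.choose s) * (c.choose r) *
                (numBPT (n - r) : ℝ) / (numBPT n : ℝ)) := by
  have e : Finset.Icc s c = Finset.Ico s (c + 1) := by ext; simp
  rw [e, Finset.sum_Ico_eq_sum_range]
  have hterm : ∀ k : ℕ, (-1 : ℝ) ^ (s + k - s) * ((s + k).choose s) * (c.choose (s + k)) *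
      (numBPT (n - (s + k)) : ℝ) / (numBPT n : ℝ)
      = (-1 : ℝ) ^ k * facMom n c (s + k) / (s.factorial * k.factorial) := by
    intro k
    unfold facMom
    rw [Nat.descFactorial_eq_factorial_mul_choose, ← Nat.add_choose_mul_factorial_mul_factorial s k,
      Nat.add_sub_cancel_left]
    have := numBPT_pos n
    have := Nat.factorial_pos s
    have := Nat.factorial_pos k
    have hs : (s + k).choose k = (s + k).choose s := Nat.choose_symm_add.symm
    push_cast
    rw [hs]
    field_simp
  rw [Finset.sum_congr rfl (fun k _ => hterm k)]
  apply hasSum_sum_of_ne_finset_zero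
  intro k hk
  rw [Finset.mem_range] at hk
  unfold facMom
  rw [Nat.descFactorial_eq_zero_iff_lt.2 (by omega : c < s + k)]
  simp

/-- There is a constant `C > 0` such that for all integers `n ≥ 4`
and all integers `c` with `1 ≤ c ≤ n/2`, setting `λ = c/(2n)`, the distribution
`s ↦ ∑_{r=s}^{c} (-1)^{r-s} C(r,s) C(c,r) b(n-r)/b(n)` is within variational distance
`C/n` of the Poisson distribution with mean `λ`. (The inner sum is empty, hence `0`,
for `s > c`.) -/
theorem variational_distance_to_poisson_le :
    ∃ C : ℝ, 0 < C ∧ ∀ n : ℕ, 4 ≤ n → ∀ c : ℕ, 1 ≤ c → (c : ℝ) ≤ (n : ℝ) / 2 →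
      ∑' s : ℕ,
          |(∑ r ∈ Finset.Icc s c,
              (-1 : ℝ) ^ (r - s) * (r.choose s) * (c.choose r) *
                (numBPT (n - r) : ℝ) / (numBPT n : ℝ)) -
            Real.exp (-((c : ℝ) / (2 * n))) * ((c : ℝ) / (2 * n)) ^ s /
              (s.factorial : ℝ)| ≤
        C / n := by
  refine ⟨12 * Real.exp 2 * Real.exp 2, by positivity, ?_⟩
  intro n hn c _ hcn
  have hc : 2 * c ≤ n := by
    have : 2 * (c : ℝ) ≤ n := by linarith
    exact_mod_cast this
  have hn' : (4 : ℝ) ≤ n := by exact_mod_cast hn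
  have hmaj : HasSum (fun s : ℕ => 12 / (n : ℝ) * Real.exp 2 * ((2 : ℝ) ^ s / (s.factorial : ℝ)))
      (12 / (n : ℝ) * Real.exp 2 * Real.exp 2) := (hasSum_exp_real 2).mul_left _
  have e : 12 * Real.exp 2 * Real.exp 2 / (n : ℝ) = 12 / (n : ℝ) * Real.exp 2 * Real.exp 2 := by
    ring
  rw [e, ← hmaj.tsum_eq]
  have hb : ∀ s : ℕ, |(∑ r ∈ Finset.Icc s c,
              (-1 : ℝ) ^ (r - s) * (r.choose s) * (c.choose r) *
                (numBPT (n - r) : ℝ) / (numBPT n : ℝ)) -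
            Real.exp (-((c : ℝ) / (2 * n))) * ((c : ℝ) / (2 * n)) ^ s /
              (s.factorial : ℝ)| ≤
        12 / (n : ℝ) * Real.exp 2 * ((2 : ℝ) ^ s / (s.factorial : ℝ)) := by
    intro s
    set l := (c : ℝ) / (2 * n) with hl
    have h1 := inner_hasSum n c s
    have h2 := (hasSum_exp_real (-l)).mul_right (l ^ s / (s.factorial : ℝ))
    have h3 := h1.sub h2
    have h4 := (hasSum_exp_real 2).mul_left (12 / (n : ℝ) * ((2 : ℝ) ^ s / (s.factorial : ℝ)))
    rw [mul_div_assoc, ← h3.tsum_eq, ← Real.norm_eq_abs,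
      show 12 / (n : ℝ) * Real.exp 2 * ((2 : ℝ) ^ s / (s.factorial : ℝ))
        = 12 / (n : ℝ) * ((2 : ℝ) ^ s / (s.factorial : ℝ)) * Real.exp 2 by ring]
    refine tsum_of_norm_bounded h4 ?_
    intro k
    have e5 : (-1 : ℝ) ^ k * facMom n c (s + k) / (s.factorial * k.factorial)
        - (-l) ^ k / (k.factorial : ℝ) * (l ^ s / (s.factorial : ℝ))
        = (-1 : ℝ) ^ k * (facMom n c (s + k) - l ^ (s + k)) / (s.factorial * k.factorial) := by
      rw [neg_pow l k, pow_add]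
      have := Nat.factorial_pos s
      have := Nat.factorial_pos k
      field_simp
    rw [e5, Real.norm_eq_abs, abs_div, abs_mul, abs_pow, abs_neg, abs_one, one_pow, one_mul,
      abs_of_pos (show (0 : ℝ) < s.factorial * k.factorial by positivity)]
    calc |facMom n c (s + k) - l ^ (s + k)| / ((s.factorial : ℝ) * k.factorial)
        ≤ (12 / n * 2 ^ (s + k)) / ((s.factorial : ℝ) * k.factorial) := by
          gcongr
          exact facMom_bound n c (s + k) hn hc
      _ = _ := by
          rw [pow_add]
          field_simp
  exact Summable.tsum_le_tsum hb
    (Summable.of_nonneg_of_le (fun _ => abs_nonneg _) hb hmaj.summable) hmaj.summable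
end
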